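/- Fix an integer k ≥ 2. In the random k-out digraph 𝒟_{n,k}, let S_n = max over vertices v outside the giant 𝒢 of |Q*(v)|, where Q*(v) is the set of vertices reachable from v using only vertices outside 𝒢. Then S_n / log n converges in probability to 1/log(1/λ_k): for every ε > 0, P(|S_n/log n − 1/log(1/λ_k)| > ε) → 0 as n → ∞. -/

import Mathlib

open scoped Classical
open Filter MeasureTheory

/-- Probability of an event under the uniform random `k`-out digraph model `𝒟_{n,k}`:
a uniformly random function `f : [n] × [k] → [n]`. -/
noncomputable def prob (n k : ℕ) (P : (Fin n × Fin k → Fin n) → Prop) : ℝ :=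
  ((Finset.univ.filter P).card : ℝ) / (Fintype.card (Fin n × Fin k → Fin n) : ℝ)

/-- One arc step: there is a labeled arc from `u` to `v`. -/
def Step {n k : ℕ} (f : Fin n × Fin k → Fin n) (u v : Fin n) : Prop :=
  ∃ i : Fin k, f (u, i) = v

/-- `u` reaches `v` by following finitely many arcs. -/
def Reaches {n k : ℕ} (f : Fin n × Fin k → Fin n) : Fin n → Fin n → Prop :=
  Relation.ReflTransGen (Step f)

/-- A set of vertices is closed if no arc leaves it. -/
def IsClosedSet {n k : ℕ} (f : Fin n × Fin k → Fin n) (S : Set (Fin n)) : Prop :=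
  ∀ v ∈ S, ∀ i : Fin k, f (v, i) ∈ S

/-- A set of vertices is strongly connected if it is nonempty and
any two of its vertices reach each other. -/
def IsStrConn {n k : ℕ} (f : Fin n × Fin k → Fin n) (S : Set (Fin n)) : Prop :=
  S.Nonempty ∧ ∀ u ∈ S, ∀ v ∈ S, Reaches f u v

/-- `G` is the giant: a closed strongly connected set of maximum size,
ties broken by choosing the one containing the smallest vertex label. -/
def IsGiant {n k : ℕ} (f : Fin n × Fin k → Fin n) (G : Set (Fin n)) : Prop :=
  IsClosedSet f G ∧ IsStrConn f G ∧
    (∀ S : Set (Fin n), IsClosedSet f S → IsStrConn f S → S.ncard ≤ G.ncard) ∧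
    (∀ S : Set (Fin n), IsClosedSet f S → IsStrConn f S → S.ncard = G.ncard →
      ∃ v ∈ G, ∀ u ∈ S, v ≤ u)

/-- Reachability using only vertices of `A` (every vertex along the way lies in `A`). -/
def ReachesIn {n k : ℕ} (f : Fin n × Fin k → Fin n) (A : Set (Fin n)) :
    Fin n → Fin n → Prop :=
  Relation.ReflTransGen (fun u v => u ∈ A ∧ v ∈ A ∧ ∃ i : Fin k, f (u, i) = v)

/-- `Q*(v)`: the set of vertices reachable from `v` using only vertices of `A`. -/
def specIn {n k : ℕ} (f : Fin n × Fin k → Fin n) (A : Set (Fin n)) (v : Fin n) :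
    Set (Fin n) :=
  {u ∈ A | ReachesIn f A v u}

/-- The number of labeled arcs of the subdigraph induced by `A`. -/
noncomputable def numArcs {n k : ℕ} (f : Fin n × Fin k → Fin n) (A : Set (Fin n)) : ℕ :=
  (Finset.univ.filter fun p : Fin n × Fin k => p.1 ∈ A ∧ f p ∈ A).card

lemma card_outcomes (n k : ℕ) : Fintype.card (Fin n × Fin k → Fin n) = n ^ (n * k) := by
  simp

lemma card_outcomes_pos (n k : ℕ) : (0 : ℝ) < Fintype.card (Fin n × Fin k → Fin n) := by
  rw [card_outcomes]
  rcases Nat.eq_zero_or_pos n with rfl | h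
  · simp
  · positivity

lemma prob_eq {n k : ℕ} (P : (Fin n × Fin k → Fin n) → Prop) [DecidablePred P] :
    prob n k P = ((Finset.univ.filter P).card : ℝ) /
      (Fintype.card (Fin n × Fin k → Fin n) : ℝ) := by
  unfold prob
  congr!

lemma prob_nonneg {n k : ℕ} (P : (Fin n × Fin k → Fin n) → Prop) : 0 ≤ prob n k P := by
  unfold prob; positivity

lemma prob_mono {n k : ℕ} {P Q : (Fin n × Fin k → Fin n) → Prop} (h : ∀ f, P f → Q f) :
    prob n k P ≤ prob n k Q := by
  unfold prob
  gcongr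
  exact h _

lemma prob_true {n k : ℕ} {P : (Fin n × Fin k → Fin n) → Prop} (h : ∀ f, P f) :
    prob n k P = 1 := by
  unfold prob
  rw [Finset.filter_true_of_mem (fun f _ => h f), Finset.card_univ]
  exact div_self (card_outcomes_pos n k).ne'

lemma prob_le_one {n k : ℕ} (P : (Fin n × Fin k → Fin n) → Prop) : prob n k P ≤ 1 := by
  rw [← prob_true (n := n) (k := k) (P := fun _ => True) (fun _ => trivial)]
  exact prob_mono fun _ _ => trivial

lemma prob_exists_le {n k : ℕ} {ι : Type*} (s : Finset ι)
    (P : ι → (Fin n × Fin k → Fin n) → Prop) :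
    prob n k (fun f => ∃ i ∈ s, P i f) ≤ ∑ i ∈ s, prob n k (P i) := by
  unfold prob
  rw [← Finset.sum_div, ← Nat.cast_sum]
  gcongr
  refine (Finset.card_le_card ?_).trans Finset.card_biUnion_le
  intro f hf
  simpa using hf

lemma prob_or_le {n k : ℕ} (P Q : (Fin n × Fin k → Fin n) → Prop) :
    prob n k (fun f => P f ∨ Q f) ≤ prob n k P + prob n k Q := by
  rw [prob_eq, prob_eq, prob_eq, ← add_div, ← Nat.cast_add]
  gcongr
  rw [Finset.filter_or]
  exact Finset.card_union_le _ _

lemma prob_not {n k : ℕ} (P : (Fin n × Fin k → Fin n) → Prop) :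
    prob n k (fun f => ¬ P f) = 1 - prob n k P := by
  have h := Finset.card_filter_add_card_filter_not (s := (Finset.univ : Finset (Fin n × Fin k → Fin n))) P
  have hp := card_outcomes_pos n k
  rw [prob_eq, prob_eq, eq_sub_iff_add_eq, ← add_div, div_eq_one_iff_eq hp.ne', ← Finset.card_univ]
  exact_mod_cast (add_comm _ _).trans h

lemma sum_prob_eq {n k : ℕ} {ι : Type*} (s : Finset ι) (g : (Fin n × Fin k → Fin n) → ι)
    (P : (Fin n × Fin k → Fin n) → Prop) :
    ∑ i ∈ s, prob n k (fun f => P f ∧ g f = i) = prob n k (fun f => P f ∧ g f ∈ s) := by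
  unfold prob
  rw [← Finset.sum_div, ← Nat.cast_sum]
  congr 2
  rw [Finset.card_eq_sum_card_fiberwise (f := g) (t := s)]
  · refine Finset.sum_congr rfl fun i hi => ?_
    congr 1
    ext f
    simp only [Finset.mem_filter, Finset.mem_univ, true_and]
    constructor
    · rintro ⟨h, rfl⟩
      exact ⟨⟨h, hi⟩, rfl⟩
    · rintro ⟨⟨h, -⟩, rfl⟩
      exact ⟨h, rfl⟩
  · intro f hf
    simp only [Finset.coe_filter, Set.mem_ofPred_eq] at hf
    exact hf.2.2

/-- Events determined by disjoint sets of rows are independent. -/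
lemma prob_and_eq_mul {n k : ℕ} (T : Set (Fin n)) (P Q : (Fin n × Fin k → Fin n) → Prop)
    (hP : ∀ f g : Fin n × Fin k → Fin n, (∀ v ∈ T, ∀ i, f (v, i) = g (v, i)) → P f → P g)
    (hQ : ∀ f g : Fin n × Fin k → Fin n, (∀ v ∉ T, ∀ i, f (v, i) = g (v, i)) → Q f → Q g) :
    prob n k (fun f => P f ∧ Q f) = prob n k P * prob n k Q := by
  let mix : (Fin n × Fin k → Fin n) → (Fin n × Fin k → Fin n) → Fin n × Fin k → Fin n :=
    fun f g p => if p.1 ∈ T then f p else g p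
  have mix_mem : ∀ f g, ∀ v ∈ T, ∀ i, mix f g (v, i) = f (v, i) := by
    intro f g v hv i; simp [mix, hv]
  have mix_notMem : ∀ f g, ∀ v ∉ T, ∀ i, mix f g (v, i) = g (v, i) := by
    intro f g v hv i; simp [mix, hv]
  have mix_mix : ∀ f g, mix (mix f g) (mix g f) = f := by
    intro f g; ext p; by_cases h : p.1 ∈ T <;> simp [mix, h]
  have hcard : (Finset.univ.filter fun f => P f ∧ Q f).card *
      Fintype.card (Fin n × Fin k → Fin n) =
      (Finset.univ.filter P).card * (Finset.univ.filter Q).card := by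
    rw [← Finset.card_univ, ← Finset.card_product, ← Finset.card_product]
    refine Finset.card_nbij' (fun x => (mix x.1 x.2, mix x.2 x.1))
      (fun x => (mix x.1 x.2, mix x.2 x.1)) ?_ ?_ ?_ ?_
    · rintro ⟨f, g⟩ h
      simp only [Finset.coe_product, Set.mem_prod, Finset.coe_filter, Set.mem_ofPred_eq,
        Finset.mem_univ, true_and] at h ⊢
      exact ⟨hP f _ (fun v hv i => (mix_mem _ _ v hv i).symm) h.1.1,
        hQ f _ (fun v hv i => (mix_notMem _ _ v hv i).symm) h.1.2⟩
    · rintro ⟨f, g⟩ h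
      simp only [Finset.coe_product, Set.mem_prod, Finset.coe_filter, Set.mem_ofPred_eq,
        Finset.mem_univ, true_and, Finset.coe_univ, Set.mem_univ, and_true] at h ⊢
      exact ⟨hP f _ (fun v hv i => (mix_mem _ _ v hv i).symm) h.1,
        hQ g _ (fun v hv i => (mix_notMem _ _ v hv i).symm) h.2⟩
    · rintro ⟨f, g⟩ -
      simp [mix_mix]
    · rintro ⟨f, g⟩ -
      simp [mix_mix]
  have hp := card_outcomes_pos n k
  rw [prob_eq, prob_eq, prob_eq, div_mul_div_comm, div_eq_div_iff hp.ne' (by positivity), ← mul_assoc]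
  congr 1
  exact_mod_cast hcard

lemma prob_forall_mem {n k : ℕ} (B : Fin n × Fin k → Finset (Fin n)) :
    prob n k (fun f => ∀ p, f p ∈ B p) = ∏ p, ((B p).card : ℝ) / n := by
  have : (Finset.univ.filter fun f : Fin n × Fin k → Fin n => ∀ p, f p ∈ B p) =
      Fintype.piFinset B := by
    ext f; simp
  rw [prob_eq, this, Fintype.card_piFinset, Finset.prod_div_distrib, card_outcomes]
  simp

/-- The rows of the vertices in `T` are independent and uniform. -/
lemma prob_row_eq {n k : ℕ} (hn : n ≠ 0) (T : Finset (Fin n)) (h : Fin n → Fin k → Fin n) :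
    prob n k (fun f => ∀ v ∈ T, ∀ i, f (v, i) = h v i) = ((n : ℝ) ^ (k * T.card))⁻¹ := by
  have h1 := prob_forall_mem (n := n) (k := k)
    (fun p => if p.1 ∈ T then {h p.1 p.2} else Finset.univ)
  have h2 : ∀ f : Fin n × Fin k → Fin n,
      (∀ p, f p ∈ (if p.1 ∈ T then {h p.1 p.2} else Finset.univ : Finset (Fin n))) ↔
        ∀ v ∈ T, ∀ i, f (v, i) = h v i := by
    intro f
    constructor
    · intro H v hv i
      simpa [hv] using H (v, i)
    · rintro H ⟨v, i⟩
      by_cases hv : v ∈ T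
      · simp [hv, H v hv i]
      · simp [hv]
  simp only [h2] at h1
  have hn' : (n : ℝ) ≠ 0 := by exact_mod_cast hn
  rw [h1, Fintype.prod_prod_type, pow_mul, ← inv_pow, ← Finset.prod_const,
    ← Finset.prod_subset (Finset.subset_univ T)]
  · refine Finset.prod_congr rfl fun v hv => ?_
    simp [hv]
  · intro v _ hv
    simp [hv, hn']

/-- The vertices reachable from `A \ X` along paths avoiding `X`. -/
noncomputable def reach {n k : ℕ} (f : Fin n × Fin k → Fin n) (X A : Finset (Fin n)) :
    Finset (Fin n) :=
  Finset.univ.filter fun u => ∃ a ∈ A, a ∉ X ∧ ReachesIn f (X : Set (Fin n))ᶜ a u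

section reach

variable {n k : ℕ} {f g : Fin n × Fin k → Fin n} {X Y A B : Finset (Fin n)}

lemma mem_reach {u : Fin n} :
    u ∈ reach f X A ↔ ∃ a ∈ A, a ∉ X ∧ ReachesIn f (X : Set (Fin n))ᶜ a u := by
  simp [reach]

lemma subset_reach {a : Fin n} (ha : a ∈ A) (hX : a ∉ X) : a ∈ reach f X A :=
  mem_reach.2 ⟨a, ha, hX, .refl⟩

lemma notMem_of_mem_reach {u : Fin n} (h : u ∈ reach f X A) : u ∉ X := by
  obtain ⟨a, -, ha, h⟩ := mem_reach.1 h
  rcases Relation.ReflTransGen.cases_tail h with rfl | ⟨c, -, -, h, -⟩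
  · exact ha
  · simpa using h

lemma reach_step {u : Fin n} (h : u ∈ reach f X A) (i : Fin k) (hX : f (u, i) ∉ X) :
    f (u, i) ∈ reach f X A := by
  obtain ⟨a, ha, haX, h'⟩ := mem_reach.1 h
  exact mem_reach.2 ⟨a, ha, haX, h'.tail ⟨by simpa using notMem_of_mem_reach h, by simpa using hX,
    i, rfl⟩⟩

/-- `reach f X A` is the least set containing `A \ X` and closed under arcs avoiding `X`. -/
lemma reach_subset (S : Finset (Fin n)) (hA : ∀ a ∈ A, a ∉ X → a ∈ S)
    (hS : ∀ u ∈ S, ∀ i, f (u, i) ∉ X → f (u, i) ∈ S) : reach f X A ⊆ S := by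
  intro u hu
  obtain ⟨a, ha, haX, h⟩ := mem_reach.1 hu
  induction h with
  | refl => exact hA a ha haX
  | tail h1 h2 ih =>
    obtain ⟨-, hc, i, rfl⟩ := h2
    exact hS _ (ih (mem_reach.2 ⟨a, ha, haX, h1⟩)) i (by simpa using hc)

lemma reach_mono (hX : Y ⊆ X) (hA : A ⊆ B) : reach f X A ⊆ reach f Y B :=
  reach_subset _ (fun _ ha haX => subset_reach (hA ha) fun h => haX (hX h))
    fun _ hu i hi => reach_step hu i fun h => hi (hX h)

lemma reach_congr (h : ∀ v ∉ X, ∀ i, f (v, i) = g (v, i)) : reach f X A = reach g X A := by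
  have key : ∀ f g : Fin n × Fin k → Fin n, (∀ v ∉ X, ∀ i, f (v, i) = g (v, i)) →
      reach f X A ⊆ reach g X A := fun f g h =>
    reach_subset _ (fun _ ha haX => subset_reach ha haX) fun u hu i hi => by
      rw [h u (notMem_of_mem_reach hu)] at hi ⊢
      exact reach_step hu i hi
  exact (key f g h).antisymm (key g f fun v hv i => (h v hv i).symm)

lemma reach_eq_of_agree {S : Finset (Fin n)} (hS : reach f X A = S)
    (h : ∀ v ∈ S, ∀ i, f (v, i) = g (v, i)) : reach g X A = S := by
  have h1 : reach g X A ⊆ S := by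
    refine reach_subset _ (fun _ ha haX => hS ▸ subset_reach ha haX) fun u hu i hi => ?_
    rw [← h u hu] at hi ⊢
    rw [← hS] at hu ⊢
    exact reach_step hu i hi
  refine h1.antisymm ?_
  have h2 : reach f X A ⊆ reach g X A := by
    refine reach_subset _ (fun _ ha haX => subset_reach ha haX) fun u hu i hi => ?_
    rw [h u (h1 hu)] at hi ⊢
    exact reach_step hu i hi
  exact hS ▸ h2

lemma reach_eq_insert {a : Fin n} (ha : a ∈ A) (haX : a ∉ X) :
    reach f X A = insert a (reach f (insert a X) (A ∪ Finset.univ.image fun i => f (a, i))) := by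
  apply Finset.Subset.antisymm
  · refine reach_subset _ (fun b hb hbX => ?_) fun u hu i hi => ?_
    · by_cases hba : b = a
      · simp [hba]
      · exact Finset.mem_insert_of_mem (subset_reach (by simp [hb]) (by simp [hba, hbX]))
    · by_cases hia : f (u, i) = a
      · simp [hia]
      · refine Finset.mem_insert_of_mem ?_
        rcases Finset.mem_insert.1 hu with rfl | hu
        · exact subset_reach (by simp) (by simp [hia, hi])
        · exact reach_step hu i (by simp [hia, hi])
  · refine Finset.insert_subset (subset_reach ha haX) (reach_subset _ (fun b hb hbX => ?_)
      fun u hu i hi => ?_)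
    · simp only [Finset.mem_insert, not_or] at hbX
      rcases Finset.mem_union.1 hb with hb | hb
      · exact subset_reach hb hbX.2
      · simp only [Finset.mem_image, Finset.mem_univ, true_and] at hb
        obtain ⟨i, rfl⟩ := hb
        exact reach_step (subset_reach ha haX) i hbX.2
    · simp only [Finset.mem_insert, not_or] at hi
      exact reach_step hu i hi.2

lemma card_reach_eq {a : Fin n} (ha : a ∈ A) (haX : a ∉ X) :
    (reach f X A).card =
      (reach f (insert a X) (A ∪ Finset.univ.image fun i => f (a, i))).card + 1 := by
  rw [reach_eq_insert ha haX, Finset.card_insert_of_notMem]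
  exact fun h => notMem_of_mem_reach h (by simp)

lemma ncard_specIn (G : Set (Fin n)) {v : Fin n} (hv : v ∉ G) :
    (specIn f Gᶜ v).ncard = (reach f G.toFinset {v}).card := by
  rw [← Set.ncard_coe_finset]
  congr 1
  ext u
  have hG : (G.toFinset : Set (Fin n)) = G := by simp
  have h1 : u ∈ reach f G.toFinset {v} ↔ ReachesIn f Gᶜ v u := by
    rw [mem_reach, hG]; simp [hv]
  rw [Finset.mem_coe, h1]
  refine ⟨fun h => h.2, fun h => ⟨?_, h⟩⟩
  simpa using notMem_of_mem_reach (h1.2 h)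

end reach

/-- Revealing the row of one vertex of the active set. -/
lemma prob_reach_succ {n k : ℕ} {X A : Finset (Fin n)} {a : Fin n} (ha : a ∈ A) (haX : a ∉ X)
    (t : ℕ) :
    prob n k (fun f => t + 1 ≤ (reach f X A).card) =
      ∑ r : Fin k → Fin n, ((n : ℝ) ^ k)⁻¹ *
        prob n k (fun f => t ≤ (reach f (insert a X) (A ∪ Finset.univ.image r)).card) := by
  have hn : n ≠ 0 := by rintro rfl; exact a.elim0
  have h := sum_prob_eq (n := n) (k := k) (Finset.univ : Finset (Fin k → Fin n))
    (fun f i => f (a, i)) (fun f => t + 1 ≤ (reach f X A).card)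
  simp only [Finset.mem_univ, and_true] at h
  rw [← h]
  refine Finset.sum_congr rfl fun r _ => ?_
  have h1 := prob_row_eq hn {a} (fun _ => r)
  simp only [Finset.card_singleton, mul_one] at h1
  rw [← h1, ← prob_and_eq_mul {a}]
  · congr 1
    ext f
    rw [card_reach_eq ha haX, Nat.add_le_add_iff_right, and_comm]
    simp only [Finset.mem_singleton, forall_eq]
    constructor
    · rintro ⟨rfl, h⟩
      exact ⟨fun i => rfl, h⟩
    · rintro ⟨h1, h⟩
      obtain rfl : (fun i => f (a, i)) = r := funext h1
      exact ⟨rfl, h⟩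
  · intro f g hfg hf v hv i
    rw [← hf v hv i, hfg v (by simpa using hv)]
  · intro f g hfg hf
    rwa [← reach_congr (f := f) (g := g)]
    intro v hv i
    exact hfg v (by simpa using fun h => hv (by simp [h])) i

lemma card_sdiff_le_of_row {n k : ℕ} {X A : Finset (Fin n)} {a : Fin n} (ha : a ∈ A) (haX : a ∉ X)
    (r : Fin k → Fin n) :
    ((A ∪ Finset.univ.image r) \ insert a X).card ≤
      ((A \ X).card - 1) + (Finset.univ.filter fun i => r i ∉ insert a X).card := by
  have h1 : (A ∪ Finset.univ.image r) \ insert a X ⊆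
      (A \ X).erase a ∪ (Finset.univ.filter fun i => r i ∉ insert a X).image r := by
    intro u hu
    simp only [Finset.mem_sdiff, Finset.mem_union, Finset.mem_image, Finset.mem_univ, true_and,
      Finset.mem_insert, not_or, Finset.mem_erase, Finset.mem_filter] at hu ⊢
    obtain ⟨h | ⟨i, rfl⟩, hua, huX⟩ := hu
    · exact .inl ⟨hua, h, huX⟩
    · exact .inr ⟨i, ⟨hua, huX⟩, rfl⟩
  calc _ ≤ _ := Finset.card_le_card h1
    _ ≤ ((A \ X).erase a).card + ((Finset.univ.filter fun i => r i ∉ insert a X).image r).card :=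
      Finset.card_union_le _ _
    _ ≤ _ := by
      rw [Finset.card_erase_of_mem (by simp [ha, haX])]
      gcongr
      exact Finset.card_image_le

lemma sum_pow_card_filter {n k : ℕ} (y : ℝ) (X : Finset (Fin n)) :
    ∑ r : Fin k → Fin n, y ^ (Finset.univ.filter fun i => r i ∉ X).card =
      (n + (n - X.card) * (y - 1)) ^ k := by
  have h1 : ∀ r : Fin k → Fin n, y ^ (Finset.univ.filter fun i => r i ∉ X).card =
      ∏ i, (if r i ∉ X then y else 1) := by
    intro r
    rw [Finset.prod_ite]
    simp
  simp only [h1]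
  rw [← Fintype.sum_pow (fun u : Fin n => if u ∉ X then y else 1)]
  congr 1
  rw [Finset.sum_ite]
  have h2 : (Finset.univ.filter fun u => u ∉ X) = Xᶜ := by ext; simp
  have h3 : (Finset.univ.filter fun u => ¬ u ∉ X) = X := by ext; simp
  rw [h2, h3, Finset.sum_const, Finset.sum_const, Finset.card_compl, Fintype.card_fin, nsmul_eq_mul,
    nsmul_eq_mul, Nat.cast_sub (by simpa using Finset.card_le_univ X)]
  ring

lemma prob_le_card_reach {n k : ℕ} {y β c : ℝ} (hy : 1 ≤ y) (hβ : 0 ≤ β)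
    (hc : (1 + c * (y - 1)) ^ k ≤ β * y)
    (t : ℕ) (X A : Finset (Fin n)) (hX : (n : ℝ) - X.card ≤ c * n) :
    prob n k (fun f => t ≤ (reach f X A).card) ≤ y ^ (A \ X).card * β ^ t := by
  have hy0 : 0 < y := by linarith
  induction t generalizing X A with
  | zero => simpa using (prob_le_one _).trans (one_le_pow₀ hy)
  | succ t ih =>
    rcases (A \ X).eq_empty_or_nonempty with hA | ⟨a, ha⟩
    · have h0 : ∀ f : Fin n × Fin k → Fin n, reach f X A = ∅ := by
        intro f
        rw [← Finset.subset_empty]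
        refine reach_subset _ (fun b hb hbX => ?_) (by simp)
        rw [← hA]; simp [hb, hbX]
      have h1 : prob n k (fun f => t + 1 ≤ (reach f X A).card) = 0 := by simp [prob, h0]
      rw [h1]; positivity
    obtain ⟨haA, haX⟩ := Finset.mem_sdiff.1 ha
    have hn : 0 < n := a.pos
    have hn' : (0 : ℝ) < n := by exact_mod_cast hn
    have hcard : ((insert a X).card : ℝ) = X.card + 1 := by
      rw [Finset.card_insert_of_notMem haX]; push_cast; rfl
    have hle : (X.card : ℝ) + 1 ≤ n := by
      rw [← hcard]
      exact_mod_cast (by simpa using Finset.card_le_univ (insert a X))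
    have hpos : 0 < (A \ X).card := Finset.card_pos.2 ⟨a, ha⟩
    rw [prob_reach_succ haA haX]
    calc _ ≤ ∑ r : Fin k → Fin n, ((n : ℝ) ^ k)⁻¹ * (y ^ ((A \ X).card - 1) *
          y ^ (Finset.univ.filter fun i => r i ∉ insert a X).card * β ^ t) := by
          gcongr with r
          refine (ih _ _ (by rw [hcard]; linarith)).trans ?_
          rw [← pow_add]
          gcongr
          exact card_sdiff_le_of_row haA haX r
      _ = ((n : ℝ) ^ k)⁻¹ * y ^ ((A \ X).card - 1) * β ^ t *
            (n + (n - (insert a X).card) * (y - 1)) ^ k := by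
          rw [← sum_pow_card_filter, Finset.mul_sum]
          exact Finset.sum_congr rfl fun r _ => by ring
      _ ≤ ((n : ℝ) ^ k)⁻¹ * y ^ ((A \ X).card - 1) * β ^ t * (n * (1 + c * (y - 1))) ^ k := by
          have h0 : 0 ≤ (n - ((insert a X).card : ℝ)) * (y - 1) :=
            mul_nonneg (by rw [hcard]; linarith) (by linarith)
          have h1 : (n - ((insert a X).card : ℝ)) * (y - 1) ≤ c * n * (y - 1) :=
            mul_le_mul_of_nonneg_right (by rw [hcard]; linarith) (by linarith)
          have h2 : (n : ℝ) + (n - (insert a X).card) * (y - 1) ≤ n * (1 + c * (y - 1)) := by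
            linarith
          gcongr
      _ = y ^ ((A \ X).card - 1) * β ^ t * (1 + c * (y - 1)) ^ k := by
          rw [mul_pow]; field_simp
      _ ≤ y ^ ((A \ X).card - 1) * β ^ t * (β * y) := by gcongr
      _ = y ^ (A \ X).card * β ^ (t + 1) := by
          obtain ⟨m, hm⟩ := Nat.exists_eq_add_of_lt hpos
          rw [hm]
          simp
          ring

lemma le_card_rows {ι α : Type*} [Fintype ι] [Fintype α] (X Y : Finset α) (J : Finset ι) :
    (Y.card + 1 - J.card) ^ J.card * X.card ^ (Fintype.card ι - J.card) ≤
      (Finset.univ.filter fun r : ι → α =>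
        (∀ i ∉ J, r i ∈ X) ∧ (∀ i ∈ J, r i ∈ Y) ∧ Set.InjOn r J).card := by
  have h1 : Fintype.card ((J ↪ Y) × ({i // i ∉ J} → X)) ≤
      (Finset.univ.filter fun r : ι → α =>
        (∀ i ∉ J, r i ∈ X) ∧ (∀ i ∈ J, r i ∈ Y) ∧ Set.InjOn r J).card := by
    rw [← Fintype.card_coe]
    refine Fintype.card_le_of_injective (fun p => ⟨fun i => if h : i ∈ J then (p.1 ⟨i, h⟩ : α) else
      p.2 ⟨i, h⟩, ?_⟩) ?_
    · simp only [Finset.mem_filter, Finset.mem_univ, true_and]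
      refine ⟨fun i hi => by simp [hi], fun i hi => by simp [hi], fun i hi j hj hij => ?_⟩
      have hi' : i ∈ J := hi
      have hj' : j ∈ J := hj
      simp only [hi', hj', dif_pos] at hij
      simpa using p.1.injective (Subtype.ext hij)
    · rintro ⟨e, x⟩ ⟨e', x'⟩ h
      have h := congrFun (congrArg Subtype.val h)
      simp only at h
      ext i
      · have := h i.1
        simpa using this
      · have := h i.1
        simpa [i.2] using this
  refine le_trans ?_ h1
  rw [Fintype.card_prod, Fintype.card_embedding_eq, Fintype.card_fun, Fintype.card_coe,
    Fintype.card_coe, Fintype.card_coe, Fintype.card_subtype_compl, Fintype.card_coe]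
  gcongr
  exact Nat.pow_sub_le_descFactorial _ _

/-- Second moment identity for the binomial distribution with mean `1`. -/
lemma sum_binomial_mul {k : ℕ} (hk : k ≠ 0) (a K : ℝ) :
    ∑ J : Finset (Fin k), (1 / k : ℝ) ^ J.card * (1 - 1 / k : ℝ) ^ (k - J.card) *
      ((a - 1 + J.card) * (K - (a - 1 + J.card))) = a * (K - a) - (1 - 1 / k) := by
  have hk' : (k : ℝ) ≠ 0 := by exact_mod_cast hk
  have h0 := congrArg (Polynomial.eval (1 / k : ℝ)) (bernsteinPolynomial.sum ℝ k)
  have h1 := congrArg (Polynomial.eval (1 / k : ℝ)) (bernsteinPolynomial.sum_smul ℝ k)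
  have h2 := congrArg (Polynomial.eval (1 / k : ℝ)) (bernsteinPolynomial.variance ℝ k)
  simp only [Polynomial.eval_finsetSum, Polynomial.eval_mul, Polynomial.eval_pow,
    Polynomial.eval_sub, Polynomial.eval_X, Polynomial.eval_natCast,
    Polynomial.eval_one, nsmul_eq_mul] at h0 h1 h2
  rw [mul_one_div_cancel hk'] at h1 h2
  have h3 : ∀ j : ℕ, (bernsteinPolynomial ℝ k j).eval (1 / k : ℝ) =
      (k.choose j : ℝ) * ((1 / k : ℝ) ^ j * (1 - 1 / k : ℝ) ^ (k - j)) := by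
    intro j; simp [bernsteinPolynomial]; ring
  have h4 := Finset.sum_powerset_apply_card (x := (Finset.univ : Finset (Fin k)))
    (fun j : ℕ => (1 / k : ℝ) ^ j * (1 - 1 / k : ℝ) ^ (k - j) *
      ((a - 1 + j) * (K - (a - 1 + j))))
  rw [Finset.powerset_univ, Finset.card_univ, Fintype.card_fin] at h4
  rw [h4]
  have h5 : ∀ j : ℕ, k.choose j • ((1 / k : ℝ) ^ j * (1 - 1 / k : ℝ) ^ (k - j) *
      ((a - 1 + j) * (K - (a - 1 + j)))) =
      ((a - 1) * (K - a + 1) + 1) * (bernsteinPolynomial ℝ k j).eval (1 / k : ℝ) +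
      (K - 2 * a) * (j * (bernsteinPolynomial ℝ k j).eval (1 / k : ℝ)) -
      (1 - (j : ℝ)) ^ 2 * (bernsteinPolynomial ℝ k j).eval (1 / k : ℝ) := by
    intro j; rw [h3, nsmul_eq_mul]; ring
  simp only [h5]
  rw [Finset.sum_sub_distrib, Finset.sum_add_distrib, ← Finset.mul_sum, ← Finset.mul_sum, h0, h1, h2]
  ring

/-- The subharmonic profile of the exploration confined to active sets of size below `K`. -/
noncomputable def profile (K : ℕ) (a : ℝ) : ℝ := max 0 (a * (K - a))

lemma profile_step {k : ℕ} (hk : 2 ≤ k) {ν y lam η : ℝ} {K : ℕ} (hη0 : 0 < η)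
    (hν : 0 < ν) (hy0 : 0 < y) (hy : (1 - ν) * y = ν / (k - 1))
    (hlam : (ν * k / (k - 1)) ^ k = lam * y) (hK : 1 ≤ η * (K - 1)) (a : ℕ) (ha1 : 1 ≤ a)
    (haK : a < K) :
    lam * (1 - η) * (y ^ a * profile K a) ≤ ∑ J : Finset (Fin k), (1 - ν) ^ J.card *
      ν ^ (k - J.card) * (y ^ (a - 1 + J.card) * profile K ((a - 1 + J.card : ℕ))) := by
  have hk1 : (0 : ℝ) < k - 1 := by
    have : (2 : ℝ) ≤ k := by exact_mod_cast hk
    linarith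
  have hk0 : (0 : ℝ) < k := by linarith
  have hlam0 : 0 < lam := by
    have : 0 < lam * y := by rw [← hlam]; positivity
    exact pos_of_mul_pos_left this hy0.le
  have ha1' : (1 : ℝ) ≤ a := by exact_mod_cast ha1
  have haK' : (a : ℝ) + 1 ≤ K := by exact_mod_cast haK
  have hterm : ∀ J : Finset (Fin k), (1 - ν) ^ J.card * ν ^ (k - J.card) * y ^ (a - 1 + J.card) =
      lam * y ^ a * ((1 / k : ℝ) ^ J.card * (1 - 1 / k : ℝ) ^ (k - J.card)) := by
    intro J
    obtain ⟨j, hj⟩ : ∃ j, k = J.card + j :=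
      Nat.exists_eq_add_of_le (by simpa using Finset.card_le_univ J)
    have hj' : k - J.card = j := by omega
    obtain ⟨b, rfl⟩ : ∃ b, a = b + 1 := ⟨a - 1, by omega⟩
    rw [hj', Nat.add_sub_cancel]
    have e1 : (1 - 1 / k : ℝ) = (k - 1) / k := by field_simp
    have e2 : (1 - ν) ^ J.card * ν ^ j * y ^ (b + J.card) =
        ((1 - ν) * y) ^ J.card * ν ^ j * y ^ b := by rw [mul_pow]; ring
    have e3 : lam * y ^ (b + 1) = (ν * k / (k - 1)) ^ k * y ^ b := by rw [hlam]; ring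
    have e4 : (ν * k / (k - 1)) ^ k = (ν * k / (k - 1)) ^ J.card * (ν * k / (k - 1)) ^ j := by
      rw [← pow_add, ← hj]
    rw [e1, e2, e3, hy, e4]
    simp only [div_pow, mul_pow, one_pow]
    field_simp
  calc lam * (1 - η) * (y ^ a * profile K a) = lam * y ^ a * ((1 - η) * (a * (K - a))) := by
        rw [profile, max_eq_right (by nlinarith)]; ring
    _ ≤ lam * y ^ a * (a * (K - a) - (1 - 1 / k)) := by
        have h1 : (K : ℝ) - 1 ≤ a * (K - a) := by nlinarith
        have h2 : 1 ≤ η * (a * (K - a)) := hK.trans (by gcongr)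
        have h3 : (0 : ℝ) < 1 / k := by positivity
        gcongr
        linarith
    _ = ∑ J : Finset (Fin k), (1 - ν) ^ J.card * ν ^ (k - J.card) * (y ^ (a - 1 + J.card) *
          ((a - 1 + J.card) * (K - (a - 1 + J.card)))) := by
        rw [← sum_binomial_mul (by omega : k ≠ 0), Finset.mul_sum]
        refine Finset.sum_congr rfl fun J _ => ?_
        rw [← mul_assoc _ (y ^ _), hterm]
        ring
    _ ≤ _ := by
        refine Finset.sum_le_sum fun J _ => ?_
        rw [← mul_assoc _ (y ^ _), ← mul_assoc _ (y ^ _), hterm]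
        have h0 : (0 : ℝ) ≤ 1 - 1 / k := by
          have : (1 : ℝ) / k ≤ 1 := by rw [div_le_one hk0]; linarith
          linarith
        gcongr
        rw [profile, Nat.cast_add, Nat.cast_sub ha1, Nat.cast_one]
        exact le_max_right _ _

lemma le_prob_reach {n k : ℕ} (hk : 2 ≤ k) {ν y lam η : ℝ} {K : ℕ} (hη0 : 0 < η) (hη1 : η < 1)
    (hν : 0 < ν) (hν1 : ν < 1) (hy1 : 1 ≤ y) (hy : (1 - ν) * y = ν / (k - 1))
    (hlam : (ν * k / (k - 1)) ^ k = lam * y) (hK : 1 ≤ η * (K - 1)) (hK0 : 0 < K)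
    (t : ℕ) (X A : Finset (Fin n)) (hXA : Disjoint A X)
    (hX : (1 - η) * ν * n ≤ X.card)
    (hX' : (X.card : ℝ) + t + K + k ≤ n - (1 - η) * (1 - ν) * n) :
    (y ^ K * K ^ 2)⁻¹ * (lam * (1 - η) ^ (k + 1)) ^ t * (y ^ A.card * profile K A.card) ≤
      prob n k (fun f => t ≤ (reach f X A).card) := by
  have hy0 : 0 < y := by linarith
  have hK0' : (0 : ℝ) < K := by exact_mod_cast hK0
  have hη1' : 0 < 1 - η := by linarith
  have hν1' : 0 < 1 - ν := by linarith
  have hprof : ∀ a : ℝ, 0 ≤ profile K a := fun a => le_max_left _ _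
  have hlam0 : 0 < lam := by
    have hk1 : (0 : ℝ) < k - 1 := by
      have : (2 : ℝ) ≤ k := by exact_mod_cast hk
      linarith
    have : 0 < lam * y := by rw [← hlam]; positivity
    exact pos_of_mul_pos_left this hy0.le
  induction t generalizing X A with
  | zero =>
    rw [prob_true (fun _ => Nat.zero_le _), pow_zero, mul_one, inv_mul_le_one₀ (by positivity)]
    by_cases hA : A.card < K
    · have hA' : (A.card : ℝ) ≤ K := by exact_mod_cast hA.le
      refine mul_le_mul (by gcongr) ?_ (hprof _) (by positivity)
      rw [profile]
      refine max_le (by positivity) ?_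
      nlinarith [Nat.cast_nonneg (α := ℝ) A.card]
    · have hA' : (K : ℝ) ≤ A.card := by exact_mod_cast not_lt.1 hA
      rw [profile, max_eq_left]
      · simp; positivity
      · exact mul_nonpos_of_nonneg_of_nonpos (by positivity) (by linarith)
  | succ t ih =>
    by_cases hA : 1 ≤ A.card ∧ A.card < K
    swap
    · have : profile K A.card = 0 := by
        rw [profile, max_eq_left]
        by_cases h : 1 ≤ A.card
        · have hA' : (K : ℝ) ≤ A.card := by exact_mod_cast not_lt.1 fun h' => hA ⟨h, h'⟩
          exact mul_nonpos_of_nonneg_of_nonpos (by positivity) (by linarith)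
        · simp [show A.card = 0 by omega]
      rw [this, mul_zero, mul_zero]
      exact prob_nonneg _
    obtain ⟨hA1, hAK⟩ := hA
    obtain ⟨a, ha⟩ := Finset.card_pos.1 hA1
    have haX : a ∉ X := Finset.disjoint_left.1 hXA ha
    have hn : 0 < n := a.pos
    have hn' : (0 : ℝ) < n := by exact_mod_cast hn
    rw [prob_reach_succ ha haX]
    set Y : Finset (Fin n) := (X ∪ A)ᶜ with hY
    have hXY : ∀ u ∈ Y, u ∉ X ∧ u ∉ A := by intro u hu; simpa [hY] using hu
    have hYcard : (Y.card : ℝ) = n - (X.card + A.card) := by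
      rw [hY, Finset.card_compl, Finset.card_union_of_disjoint hXA.symm, Fintype.card_fin,
        Nat.cast_sub, Nat.cast_add]
      rw [← Finset.card_union_of_disjoint hXA.symm]
      simpa using Finset.card_le_univ (X ∪ A)
    have hAK' : (A.card : ℝ) ≤ K := by exact_mod_cast hAK.le
    set good : Finset (Fin k) → Finset (Fin k → Fin n) := fun J => Finset.univ.filter fun r =>
      (∀ i ∉ J, r i ∈ X) ∧ (∀ i ∈ J, r i ∈ Y) ∧ Set.InjOn r J with hgood
    have hgoodcard : ∀ J, ((1 - η) * (1 - ν) * n) ^ J.card * ((1 - η) * ν * n) ^ (k - J.card) ≤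
        ((good J).card : ℝ) := by
      intro J
      have hJ : J.card ≤ k := by simpa using Finset.card_le_univ J
      have hJ' : (J.card : ℝ) ≤ k := by exact_mod_cast hJ
      have h1 := le_card_rows X Y J
      rw [Fintype.card_fin] at h1
      have h3 : _ ≤ (good J).card := h1.trans_eq (by congr!)
      refine le_trans ?_ (Nat.cast_le (α := ℝ).2 h3)
      push_cast at hX' ⊢
      have h2 : (Y.card : ℝ) + 1 - J.card ≤ ((Y.card + 1 - J.card : ℕ) : ℝ) := by
        rw [sub_le_iff_le_add]
        exact_mod_cast (by omega : Y.card + 1 ≤ Y.card + 1 - J.card + J.card)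
      gcongr
      have : (0 : ℝ) ≤ t := by positivity
      linarith
    have hdisj : Set.PairwiseDisjoint (Set.univ : Set (Finset (Fin k))) good := by
      have key : ∀ J J' : Finset (Fin k), ∀ r, r ∈ good J → r ∈ good J' → J ⊆ J' := by
        intro J J' r hr hr' i hi
        by_contra hi'
        simp only [hgood, Finset.mem_filter, Finset.mem_univ, true_and] at hr hr'
        exact (hXY _ (hr.2.1 i hi)).1 (hr'.1 i hi')
      intro J _ J' _ hne
      refine Finset.disjoint_left.2 fun r hr hr' => hne ?_
      exact (key J J' r hr hr').antisymm (key J' J r hr' hr)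
    set κ : ℝ := (y ^ K * K ^ 2)⁻¹ with hκ
    have hκ0 : 0 < κ := by positivity
    set θ := lam * (1 - η) ^ (k + 1) with hθ
    have hθ0 : 0 < θ := by positivity
    have hgoodprob : ∀ J, ∀ r ∈ good J,
        κ * θ ^ t * (y ^ (A.card - 1 + J.card) * profile K ((A.card - 1 + J.card : ℕ))) ≤
          prob n k (fun f => t ≤ (reach f (insert a X) (A ∪ Finset.univ.image r)).card) := by
      intro J r hr
      simp only [hgood, Finset.mem_filter, Finset.mem_univ, true_and] at hr
      obtain ⟨-, hr1, hr2⟩ := hr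
      have hc : (A.erase a ∪ J.image r).card = A.card - 1 + J.card := by
        rw [Finset.card_union_of_disjoint, Finset.card_erase_of_mem ha, Finset.card_image_of_injOn hr2]
        refine Finset.disjoint_left.2 fun u hu hu' => ?_
        obtain ⟨i, hi, rfl⟩ := Finset.mem_image.1 hu'
        exact (hXY _ (hr1 i hi)).2 (Finset.mem_of_mem_erase hu)
      have h1 := ih (insert a X) (A.erase a ∪ J.image r) ?_ ?_ ?_
      · rw [hc] at h1
        refine h1.trans (prob_mono fun f hf => hf.trans (Finset.card_le_card ?_))
        refine reach_mono subset_rfl (Finset.union_subset_union (Finset.erase_subset _ _) ?_)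
        exact Finset.image_subset_image (Finset.subset_univ J)
      · refine Finset.disjoint_left.2 fun u hu hu' => ?_
        rcases Finset.mem_union.1 hu with hu | hu
        · rcases Finset.mem_insert.1 hu' with rfl | hu'
          · simp at hu
          · exact Finset.disjoint_left.1 hXA (Finset.mem_of_mem_erase hu) hu'
        · obtain ⟨i, hi, rfl⟩ := Finset.mem_image.1 hu
          rcases Finset.mem_insert.1 hu' with h | h
          · exact (hXY _ (hr1 i hi)).2 (h ▸ ha)
          · exact (hXY _ (hr1 i hi)).1 h
      · rw [Finset.card_insert_of_notMem haX]; push_cast; linarith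
      · rw [Finset.card_insert_of_notMem haX]; push_cast at hX' ⊢; linarith
    calc κ * θ ^ (t + 1) * (y ^ A.card * profile K A.card)
        = κ * θ ^ t * (1 - η) ^ k * (lam * (1 - η) * (y ^ A.card * profile K A.card)) := by
          rw [pow_succ θ, hθ]; ring
      _ ≤ κ * θ ^ t * (1 - η) ^ k * ∑ J : Finset (Fin k), (1 - ν) ^ J.card *
            ν ^ (k - J.card) *
              (y ^ (A.card - 1 + J.card) * profile K ((A.card - 1 + J.card : ℕ))) := by
          gcongr
          exact profile_step hk hη0 hν hy0 hy hlam hK _ hA1 hAK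
      _ = ∑ J : Finset (Fin k), ((n : ℝ) ^ k)⁻¹ *
            (((1 - η) * (1 - ν) * n) ^ J.card * ((1 - η) * ν * n) ^ (k - J.card)) *
            (κ * θ ^ t * (y ^ (A.card - 1 + J.card) * profile K ((A.card - 1 + J.card : ℕ)))) := by
          rw [Finset.mul_sum]
          refine Finset.sum_congr rfl fun J _ => ?_
          obtain ⟨j, hj⟩ : ∃ j, k = J.card + j :=
            Nat.exists_eq_add_of_le (by simpa using Finset.card_le_univ J)
          have hj' : k - J.card = j := by omega
          have e1 : (1 - η) ^ k = (1 - η) ^ J.card * (1 - η) ^ j := by rw [← pow_add, ← hj]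
          have e2 : (n : ℝ) ^ k = n ^ J.card * n ^ j := by rw [← pow_add, ← hj]
          rw [hj', e1, e2]
          simp only [mul_pow]
          field_simp
      _ ≤ ∑ J : Finset (Fin k), ∑ r ∈ good J, ((n : ℝ) ^ k)⁻¹ *
            prob n k (fun f => t ≤ (reach f (insert a X) (A ∪ Finset.univ.image r)).card) := by
          refine Finset.sum_le_sum fun J _ => ?_
          calc _ ≤ ((n : ℝ) ^ k)⁻¹ * ((good J).card : ℝ) * (κ * θ ^ t *
                  (y ^ (A.card - 1 + J.card) * profile K ((A.card - 1 + J.card : ℕ)))) := by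
                have := hprof ((A.card - 1 + J.card : ℕ))
                gcongr
                exact hgoodcard J
            _ = ∑ r ∈ good J, ((n : ℝ) ^ k)⁻¹ * (κ * θ ^ t *
                  (y ^ (A.card - 1 + J.card) * profile K ((A.card - 1 + J.card : ℕ)))) := by
                rw [Finset.sum_const, nsmul_eq_mul]; ring
            _ ≤ _ := by
                refine Finset.sum_le_sum fun r hr => ?_
                gcongr
                exact hgoodprob J r hr
      _ = ∑ r ∈ Finset.univ.biUnion good, ((n : ℝ) ^ k)⁻¹ *
            prob n k (fun f => t ≤ (reach f (insert a X) (A ∪ Finset.univ.image r)).card) := by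
          rw [Finset.sum_biUnion]
          simpa using hdisj
      _ ≤ _ := Finset.sum_le_sum_of_subset_of_nonneg (Finset.subset_univ _) fun r _ _ =>
          mul_nonneg (by positivity) (prob_nonneg _)

/-- Repeated attempts: explore from fresh vertices until some exploration finds `t` vertices. -/
lemma prob_forall_reach_lt_le {n k t m b : ℕ} {p : ℝ}
    (hstep : ∀ (X : Finset (Fin n)) (v : Fin n), v ∉ X → m ≤ X.card → X.card ≤ b →
      p ≤ prob n k (fun f => t ≤ (reach f X {v}).card)) (hb : b < n)
    (J : ℕ) (X : Finset (Fin n)) (hmX : m ≤ X.card) (hX : X.card + J * t ≤ b) :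
    prob n k (fun f => ∀ v ∉ X, (reach f X {v}).card < t) ≤ Real.exp (-p) ^ J := by
  induction J generalizing X with
  | zero => simpa using prob_le_one _
  | succ J ih =>
    obtain ⟨v, hv⟩ : ∃ v, v ∉ X := by
      by_contra! h
      have : X = Finset.univ := by ext; simp [h]
      rw [this] at hX
      simp at hX
      omega
    set small : Finset (Finset (Fin n)) := Finset.univ.filter fun S => S.card < t with hsmall
    have h1 := hstep X v hv hmX (by omega)
    calc _ ≤ prob n k (fun f => ∃ S ∈ small,
          reach f X {v} = S ∧ ∀ u ∉ X ∪ S, (reach f (X ∪ S) {u}).card < t) := by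
          refine prob_mono fun f hf => ⟨reach f X {v}, ?_, rfl, fun u hu => ?_⟩
          · simpa [hsmall] using hf v hv
          · refine (Finset.card_le_card (reach_mono Finset.subset_union_left subset_rfl)).trans_lt
              (hf u fun h => hu (Finset.mem_union_left _ h))
      _ ≤ ∑ S ∈ small, prob n k (fun f => reach f X {v} = S ∧
            ∀ u ∉ X ∪ S, (reach f (X ∪ S) {u}).card < t) := prob_exists_le _ _
      _ ≤ ∑ S ∈ small, prob n k (fun f => True ∧ reach f X {v} = S) * Real.exp (-p) ^ J := by
          refine Finset.sum_le_sum fun S hS => ?_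
          rw [prob_and_eq_mul (S : Set (Fin n))]
          · simp only [true_and]
            refine mul_le_mul_of_nonneg_left (ih _ (hmX.trans
              (Finset.card_le_card Finset.subset_union_left)) ?_) (prob_nonneg _)
            have := Finset.card_union_le X S
            have : S.card < t := by simpa [hsmall] using hS
            nlinarith
          · intro f g hfg hf
            exact reach_eq_of_agree hf hfg
          · intro f g hfg hf u hu
            rw [← reach_congr (f := f)]
            · exact hf u hu
            · intro w hw i
              exact hfg w (by simp at hw ⊢; exact hw.2) i
      _ = (1 - prob n k (fun f => t ≤ (reach f X {v}).card)) * Real.exp (-p) ^ J := by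
          rw [← Finset.sum_mul, sum_prob_eq, ← prob_not]
          simp [hsmall]
      _ ≤ Real.exp (-p) * Real.exp (-p) ^ J := by
          gcongr
          linarith [Real.one_sub_le_exp_neg p]
      _ = _ := (pow_succ' _ _).symm

/-- Functions on `A` (extended by `0`) onto `{0, …, j - 1}`. -/
noncomputable def ontoFuns {α : Type*} [Fintype α] (A : Finset α) (j : ℕ) : Finset (α → ℕ) :=
  (Fintype.piFinset fun a => if a ∈ A then Finset.range j else {0}).filter fun h =>
    ∀ b < j, ∃ a ∈ A, h a = b

lemma mem_ontoFuns {α : Type*} [Fintype α] {A : Finset α} {j : ℕ} {h : α → ℕ} :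
    h ∈ ontoFuns A j ↔
      (∀ a ∈ A, h a < j) ∧ (∀ a ∉ A, h a = 0) ∧ ∀ b < j, ∃ a ∈ A, h a = b := by
  simp only [ontoFuns, Finset.mem_filter, Fintype.mem_piFinset, ← and_assoc]
  refine and_congr_left fun _ => ⟨fun H => ⟨fun a ha => ?_, fun a ha => ?_⟩, fun H a => ?_⟩
  · simpa [ha] using H a
  · simpa [ha] using H a
  · by_cases ha : a ∈ A
    · simpa [ha] using H.1 a ha
    · simpa [ha] using H.2 a ha

lemma card_ontoFuns_succ_le {α : Type*} [Fintype α] (A : Finset α) (j : ℕ) :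
    (ontoFuns A (j + 1)).card ≤
      ∑ B ∈ A.powerset, if B.card = 0 then 0 else (ontoFuns (A \ B) j).card := by
  rw [Finset.card_eq_sum_card_fiberwise (f := fun h => A.filter fun a => h a = j) (t := A.powerset)]
  · refine Finset.sum_le_sum fun B hB => ?_
    split_ifs with hB0
    · rw [Nat.le_zero, Finset.card_eq_zero, Finset.filter_eq_empty_iff]
      intro h hh hhB
      obtain ⟨a, ha, haj⟩ := (mem_ontoFuns.1 hh).2.2 j (by omega)
      have : a ∈ B := by rw [← hhB]; simp [ha, haj]
      simp [Finset.card_eq_zero.1 hB0] at this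
    · refine Finset.card_le_card_of_injOn (fun h a => if a ∈ B then 0 else h a) ?_ ?_
      · intro h hh
        simp only [Finset.coe_filter, Set.mem_ofPred_eq] at hh
        obtain ⟨hh, hhB⟩ := hh
        obtain ⟨h1, h2, h3⟩ := mem_ontoFuns.1 hh
        simp only [Finset.mem_coe, mem_ontoFuns, Finset.mem_sdiff]
        refine ⟨fun a ha => ?_, fun a ha => ?_, fun b hb => ?_⟩
        · have h4 : ¬ h a = j := fun h' => ha.2 (by rw [← hhB]; simp [ha.1, h'])
          have := h1 a ha.1
          simp only [ha.2, if_false]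
          omega
        · by_cases haB : a ∈ B
          · simp [haB]
          · simp [haB, h2 a fun h => ha ⟨h, haB⟩]
        · obtain ⟨a, ha, hab⟩ := h3 b (by omega)
          have haB : a ∉ B := by
            rw [← hhB]
            simp only [Finset.mem_filter, not_and]
            omega
          exact ⟨a, ⟨ha, haB⟩, by simp [haB, hab]⟩
      · intro h hh h' hh' heq
        simp only [Finset.coe_filter, Set.mem_ofPred_eq] at hh hh'
        funext a
        have := congrFun heq a
        by_cases haB : a ∈ B
        · have e1 := haB
          have e2 := haB
          rw [← hh.2] at e1
          rw [← hh'.2] at e2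
          rw [(Finset.mem_filter.1 e1).2, (Finset.mem_filter.1 e2).2]
        · simpa [haB] using this
  · intro h _
    rw [Finset.mem_coe, Finset.mem_powerset]
    exact Finset.filter_subset _ _

lemma card_ontoFuns_mul_le {α : Type*} [Fintype α] {z : ℝ} (hz : 0 ≤ z) (A : Finset α) (j : ℕ) :
    (ontoFuns A j).card * z ^ A.card ≤ A.card.factorial * (Real.exp z - 1) ^ j := by
  have hφ : 0 ≤ Real.exp z - 1 := by linarith [Real.one_le_exp hz]
  induction j generalizing A with
  | zero =>
    by_cases hA : A = ∅
    · subst hA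
      have : (ontoFuns (∅ : Finset α) 0).card ≤ 1 := by
        refine Finset.card_le_one.2 fun h hh h' hh' => funext fun a => ?_
        rw [(mem_ontoFuns.1 hh).2.1 a (by simp), (mem_ontoFuns.1 hh').2.1 a (by simp)]
      simpa using this
    · obtain ⟨a, ha⟩ := Finset.nonempty_iff_ne_empty.2 hA
      have : ontoFuns A 0 = ∅ := by
        rw [Finset.eq_empty_iff_forall_notMem]
        intro h hh
        exact absurd ((mem_ontoFuns.1 hh).1 a ha) (by omega)
      rw [this]
      simp
  | succ j ih =>
    calc ((ontoFuns A (j + 1)).card : ℝ) * z ^ A.card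
        ≤ (∑ B ∈ A.powerset, if B.card = 0 then (0 : ℝ) else (ontoFuns (A \ B) j).card) *
            z ^ A.card := by
          gcongr
          exact_mod_cast card_ontoFuns_succ_le A j
      _ ≤ ∑ B ∈ A.powerset, (fun m : ℕ => if m = 0 then (0 : ℝ) else
            z ^ m * (A.card - m).factorial * (Real.exp z - 1) ^ j) B.card := by
          rw [Finset.sum_mul]
          refine Finset.sum_le_sum fun B hB => ?_
          have hB := Finset.mem_powerset.1 hB
          dsimp only
          split_ifs with h0
          · simp
          · have h1 := ih (A \ B)
            rw [Finset.card_sdiff_of_subset hB] at h1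
            have h2 : z ^ A.card = z ^ (A.card - B.card) * z ^ B.card := by
              rw [← pow_add, Nat.sub_add_cancel (Finset.card_le_card hB)]
            rw [h2, ← mul_assoc, mul_comm, mul_assoc]
            gcongr
      _ = A.card.factorial * (Real.exp z - 1) ^ j *
            ∑ m ∈ Finset.range (A.card + 1), if m = 0 then (0 : ℝ) else z ^ m / m.factorial := by
          rw [Finset.sum_powerset_apply_card (fun m : ℕ => if m = 0 then (0 : ℝ) else
            z ^ m * (A.card - m).factorial * (Real.exp z - 1) ^ j), Finset.mul_sum]
          refine Finset.sum_congr rfl fun m hm => ?_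
          have hm : m ≤ A.card := by simpa [Nat.lt_succ_iff] using hm
          split_ifs with h0
          · simp
          · have h1 := Nat.choose_mul_factorial_mul_factorial hm
            rw [nsmul_eq_mul, ← h1]
            push_cast
            field_simp
      _ ≤ A.card.factorial * (Real.exp z - 1) ^ j * (Real.exp z - 1) := by
          have h1 := Real.sum_le_exp_of_nonneg hz (A.card + 1)
          rw [Finset.sum_range_succ'] at h1 ⊢
          simp at h1 ⊢
          gcongr
          linarith
      _ = _ := by ring

/-- Each vertex of `S` sends all its arcs into `S` and receives an arc from `S`. -/
def IsCovered {n k : ℕ} (f : Fin n × Fin k → Fin n) (S : Finset (Fin n)) : Prop :=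
  (∀ v ∈ S, ∀ i, f (v, i) ∈ S) ∧ ∀ v ∈ S, ∃ u ∈ S, ∃ i, f (u, i) = v

lemma prob_isCovered_le {n k : ℕ} {z : ℝ} (hz : 0 < z) (S : Finset (Fin n)) (hS : S.Nonempty) :
    prob n k (fun f => IsCovered f S) ≤
      (k * S.card).factorial * (Real.exp z - 1) ^ S.card / (z ^ (k * S.card) * n ^ (k * S.card)) := by
  obtain ⟨v0, hv0⟩ := hS
  have hn : n ≠ 0 := v0.pos.ne'
  have hn' : (0 : ℝ) < n := by exact_mod_cast v0.pos
  let e : Fin n → ℕ := fun u => if h : u ∈ S then (S.equivFin ⟨u, h⟩ : ℕ) else 0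
  let g : ℕ → Fin n := fun b => if h : b < S.card then (S.equivFin.symm ⟨b, h⟩ : Fin n) else v0
  have hge : ∀ u ∈ S, g (e u) = u := by
    intro u hu
    simp [g, e, hu]
  have hes : ∀ u ∈ S, e u < S.card := by
    intro u hu
    simp [e, hu]
  have hegS : ∀ b < S.card, g b ∈ S ∧ e (g b) = b := by
    intro b hb
    simp [g, e, hb]
  let A : Finset (Fin n × Fin k) := S ×ˢ Finset.univ
  have hA : A.card = k * S.card := by simp [A, mul_comm]
  let enc : (Fin n × Fin k → Fin n) → (Fin n × Fin k → ℕ) := fun f p =>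
    if p ∈ A then e (f p) else 0
  have hmem : ∀ f, IsCovered f S → enc f ∈ ontoFuns A S.card := by
    intro f hf
    refine mem_ontoFuns.2 ⟨fun a ha => ?_, fun a ha => by simp [enc, ha], fun b hb => ?_⟩
    · simp only [enc, ha, if_true]
      exact hes _ (hf.1 a.1 (Finset.mem_product.1 ha).1 a.2)
    · obtain ⟨u, hu, i, hui⟩ := hf.2 (g b) (hegS b hb).1
      have : (u, i) ∈ A := by simp [A, hu]
      exact ⟨(u, i), this, by simp only [enc, this, if_true, hui, (hegS b hb).2]⟩
  calc _ = prob n k (fun f => IsCovered f S ∧ enc f ∈ ontoFuns A S.card) := by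
        congr 1; ext f; exact ⟨fun h => ⟨h, hmem f h⟩, fun h => h.1⟩
    _ = ∑ h ∈ ontoFuns A S.card, prob n k (fun f => IsCovered f S ∧ enc f = h) :=
        (sum_prob_eq _ _ _).symm
    _ ≤ ∑ h ∈ ontoFuns A S.card, ((n : ℝ) ^ (k * S.card))⁻¹ := by
        refine Finset.sum_le_sum fun h _ => ?_
        rw [← prob_row_eq hn S (fun v i => g (h (v, i)))]
        refine prob_mono fun f hf v hv i => ?_
        have : (v, i) ∈ A := by simp [A, hv]
        rw [← hf.2]
        simp only [enc, this, if_true]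
        rw [hge _ (hf.1.1 v hv i)]
    _ ≤ _ := by
        rw [Finset.sum_const, nsmul_eq_mul]
        have h1 := card_ontoFuns_mul_le hz.le A S.card
        rw [hA] at h1
        rw [← div_div, ← div_eq_mul_inv]
        gcongr
        rwa [le_div_iff₀ (by positivity)]

lemma prob_isCovered_le_div_pow {n k : ℕ} (S : Finset (Fin n)) :
    prob n k (fun f => IsCovered f S) ≤ ((S.card : ℝ) / n) ^ (k * S.card) := by
  rcases Nat.eq_zero_or_pos n with rfl | hn
  · rw [Finset.eq_empty_of_isEmpty S]; simpa using prob_le_one _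
  have h1 := prob_forall_mem (n := n) (k := k) (fun p => if p.1 ∈ S then S else Finset.univ)
  refine (prob_mono fun f hf => ?_).trans (h1.trans_le (le_of_eq ?_))
  · rintro ⟨v, i⟩
    by_cases hv : v ∈ S
    · simpa [hv] using hf.1 v hv i
    · simp [hv]
  · have hn' : (n : ℝ) ≠ 0 := by exact_mod_cast hn.ne'
    rw [Fintype.prod_prod_type, pow_mul, ← Finset.prod_const,
      ← Finset.prod_subset (Finset.subset_univ S)]
    · refine Finset.prod_congr rfl fun v hv => ?_
      simp [hv, div_pow]
    · intro v _ hv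
      simp [hv, hn']

/-- The exponential growth rate of the expected number of closed sets without sources,
as a function of their relative size. -/
noncomputable def rate (κ ν x : ℝ) : ℝ :=
  (κ - 1) * (x * Real.log x) + Real.negMulLog (1 - x) - κ * x + (κ * ν - (κ - 1) * Real.log ν) * x

/-- The derivative of `rate`. -/
noncomputable def rateDeriv (κ ν x : ℝ) : ℝ :=
  (κ - 1) * Real.log x + Real.log (1 - x) + κ * ν - (κ - 1) * Real.log ν

lemma continuous_rate (κ ν : ℝ) : Continuous (rate κ ν) := by
  have := Real.continuous_mul_log
  have := Real.continuous_negMulLog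
  unfold rate
  fun_prop

lemma hasDerivAt_rate {κ ν x : ℝ} (h0 : 0 < x) (h1 : x < 1) :
    HasDerivAt (rate κ ν) (rateDeriv κ ν x) x := by
  have d1 := (Real.hasDerivAt_mul_log h0.ne').const_mul (κ - 1)
  have d2 := (Real.hasDerivAt_negMulLog (x := 1 - x) (by linarith)).comp x
    ((hasDerivAt_id x).const_sub 1)
  have d3 := (hasDerivAt_id x).const_mul κ
  have d4 := (hasDerivAt_id x).const_mul (κ * ν - (κ - 1) * Real.log ν)
  refine (((d1.add d2).sub d3).add d4).congr_deriv ?_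
  unfold rateDeriv
  ring

lemma rateDeriv_sub_le {κ ν x y : ℝ} (hκ : 1 ≤ κ) (h0 : 0 < x) (hxy : x ≤ y) (h1 : y < 1) :
    (y - x) * ((κ - 1) / y - 1 / (1 - y)) ≤ rateDeriv κ ν y - rateDeriv κ ν x ∧
    rateDeriv κ ν y - rateDeriv κ ν x ≤ (y - x) * ((κ - 1) / x - 1 / (1 - x)) := by
  have hy0 : 0 < y := by linarith
  have e1 := Real.one_sub_inv_le_log_of_pos (div_pos hy0 h0)
  have e2 := Real.log_le_sub_one_of_pos (div_pos hy0 h0)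
  have e3 := Real.one_sub_inv_le_log_of_pos (div_pos (by linarith : 0 < 1 - x) (by linarith : 0 < 1 - y))
  have e4 := Real.log_le_sub_one_of_pos (div_pos (by linarith : 0 < 1 - x) (by linarith : 0 < 1 - y))
  have hx1 : 1 - x ≠ 0 := by linarith
  have hy1 : 1 - y ≠ 0 := by linarith
  rw [Real.log_div hy0.ne' h0.ne'] at e1 e2
  rw [Real.log_div hx1 hy1] at e3 e4
  have f1 : 1 - (y / x)⁻¹ = (y - x) / y := by field_simp
  have f2 : y / x - 1 = (y - x) / x := by field_simp
  have f3 : 1 - ((1 - x) / (1 - y))⁻¹ = (y - x) / (1 - x) := by field_simp; ring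
  have f4 : (1 - x) / (1 - y) - 1 = (y - x) / (1 - y) := by field_simp; ring
  rw [f1] at e1; rw [f2] at e2; rw [f3] at e3; rw [f4] at e4
  have g1 := mul_le_mul_of_nonneg_left e1 (by linarith : 0 ≤ κ - 1)
  have g2 := mul_le_mul_of_nonneg_left e2 (by linarith : 0 ≤ κ - 1)
  have r1 : (y - x) * ((κ - 1) / y - 1 / (1 - y)) = (κ - 1) * ((y - x) / y) - (y - x) / (1 - y) := by
    ring
  have r2 : (y - x) * ((κ - 1) / x - 1 / (1 - x)) = (κ - 1) * ((y - x) / x) - (y - x) / (1 - x) := by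
    ring
  rw [r1, r2]
  unfold rateDeriv
  constructor <;> linarith

lemma rate_neg {κ ν x : ℝ} (hκ : 1 < κ) (hν : 0 < ν) (hν1 : ν < 1) (hκν : κ * (1 - ν) < 1)
    (hlog : Real.log (1 - ν) = -(κ * ν)) (hx : 0 < x) (hx1 : x ≤ 1) (hne : x ≠ ν) :
    rate κ ν x < 0 := by
  have hν0 : rate κ ν ν = 0 := by
    unfold rate Real.negMulLog; rw [hlog]; ring
  have hd0 : rateDeriv κ ν ν = 0 := by
    unfold rateDeriv; rw [hlog]; ring
  set c : ℝ := (κ - 1) / κ with hc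
  have hc0 : 0 < c := div_pos (by linarith) (by linarith)
  have hκ0 : 0 < κ := by linarith
  have hcκ : c * κ = κ - 1 := by rw [hc]; field_simp
  have hcν : c < ν := by rw [hc, div_lt_iff₀ hκ0]; linarith
  have sgn : ∀ y, 0 < y → y < 1 → (c < y → (κ - 1) / y - 1 / (1 - y) < 0) ∧
      (y ≤ c → 0 ≤ (κ - 1) / y - 1 / (1 - y)) := by
    intro y hy0 hy1
    have h1 : 0 < 1 - y := by linarith
    rw [div_sub_div _ _ hy0.ne' h1.ne']
    constructor
    · intro h
      apply div_neg_of_neg_of_pos _ (by positivity)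
      nlinarith
    · intro h
      apply div_nonneg _ (by positivity)
      nlinarith
  have hright : StrictAntiOn (rate κ ν) (Set.Icc ν 1) := by
    refine strictAntiOn_of_deriv_neg (convex_Icc _ _) (continuous_rate κ ν).continuousOn ?_
    intro y hy
    rw [interior_Icc] at hy
    rw [(hasDerivAt_rate (hν.trans hy.1) hy.2).deriv]
    have h1 := (rateDeriv_sub_le (ν := ν) hκ.le hν hy.1.le hy.2).2
    have h2 := mul_neg_of_pos_of_neg (sub_pos.2 hy.1) ((sgn ν hν hν1).1 hcν)
    linarith
  have hmid : StrictMonoOn (rate κ ν) (Set.Icc c ν) := by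
    refine strictMonoOn_of_deriv_pos (convex_Icc _ _) (continuous_rate κ ν).continuousOn ?_
    intro y hy
    rw [interior_Icc] at hy
    have hy0 : 0 < y := hc0.trans hy.1
    have hy1 : y < 1 := hy.2.trans hν1
    rw [(hasDerivAt_rate hy0 hy1).deriv]
    have h1 := (rateDeriv_sub_le (ν := ν) hκ.le hy0 hy.2.le hν1).2
    have h2 := mul_neg_of_pos_of_neg (sub_pos.2 hy.2) ((sgn y hy0 hy1).1 hy.1)
    linarith
  have hc_neg : rate κ ν c < 0 :=
    hν0 ▸ hmid ⟨le_rfl, hcν.le⟩ ⟨hcν.le, le_rfl⟩ hcν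
  rcases lt_or_gt_of_ne hne with h | h
  · rcases le_or_gt x c with hxc | hxc
    · have hconv : ConvexOn ℝ (Set.Icc 0 c) (rate κ ν) := by
        have hder : ∀ y ∈ interior (Set.Icc 0 c), HasDerivAt (rate κ ν) (rateDeriv κ ν y) y := by
          intro y hy
          rw [interior_Icc] at hy
          exact hasDerivAt_rate hy.1 (hy.2.trans (hcν.trans hν1))
        refine MonotoneOn.convexOn_of_deriv (convex_Icc _ _) (continuous_rate κ ν).continuousOn
          (fun y hy => (hder y hy).differentiableAt.differentiableWithinAt) ?_
        intro y hy z hz hyz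
        rw [(hder y hy).deriv, (hder z hz).deriv]
        rw [interior_Icc] at hy hz
        have hz1 : z < 1 := hz.2.trans (hcν.trans hν1)
        have h1 := (rateDeriv_sub_le (ν := ν) hκ.le hy.1 hyz hz1).1
        have h2 := mul_nonneg (sub_nonneg.2 hyz) ((sgn z hz.1 hz1).2 hz.2.le)
        linarith
      have h0 : rate κ ν 0 = 0 := by simp [rate]
      have hxc' : x / c ≤ 1 := (div_le_one hc0).2 hxc
      have h1 := hconv.2 (Set.left_mem_Icc.2 hc0.le) (Set.right_mem_Icc.2 hc0.le)
        (by linarith : 0 ≤ 1 - x / c) (by positivity : 0 ≤ x / c) (by ring)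
      simp only [smul_eq_mul, h0, mul_zero, zero_add] at h1
      rw [div_mul_cancel₀ _ hc0.ne'] at h1
      exact h1.trans_lt (mul_neg_of_pos_of_neg (by positivity) hc_neg)
    · exact hν0 ▸ hmid ⟨hxc.le, h.le⟩ ⟨hcν.le, le_rfl⟩ h
  · exact hν0 ▸ hright ⟨le_rfl, hν1.le⟩ ⟨h.le, hx1⟩ h

lemma exists_rate_le {κ ν δ d : ℝ} (hκ : 1 < κ) (hν : 0 < ν) (hν1 : ν < 1) (hκν : κ * (1 - ν) < 1)
    (hlog : Real.log (1 - ν) = -(κ * ν)) (hδ : 0 < δ) (hd : 0 < d) :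
    ∃ c > 0, ∀ x, d ≤ x → x ≤ 1 → δ ≤ |x - ν| → rate κ ν x ≤ -c := by
  let s : Set ℝ := Set.Icc d 1 ∩ {x | δ ≤ |x - ν|}
  have hs : IsCompact s := isCompact_Icc.inter_right
    (isClosed_le continuous_const (by fun_prop))
  rcases s.eq_empty_or_nonempty with he | hne
  · refine ⟨1, one_pos, fun x h1 h2 h3 => ?_⟩
    have : x ∈ s := ⟨⟨h1, h2⟩, h3⟩
    simp [he] at this
  · obtain ⟨x, hx, hmax⟩ := hs.exists_isMaxOn hne (continuous_rate κ ν).continuousOn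
    refine ⟨-rate κ ν x, ?_, fun y h1 h2 h3 => ?_⟩
    · have hxν : x ≠ ν := by
        rintro rfl
        have : δ ≤ |x - x| := hx.2
        simp at this
        linarith
      have := rate_neg hκ hν hν1 hκν hlog (hd.trans_le hx.1.1) hx.1.2 hxν
      linarith
    · rw [neg_neg]
      exact hmax (show y ∈ s from ⟨⟨h1, h2⟩, h3⟩)

lemma mul_lt_one_of_fixed {κ τ : ℝ} (hκ : 0 < κ) (hτpos : 0 < τ)
    (hτ : 1 - τ / κ - Real.exp (-τ) = 0) : κ * (1 - τ / κ) < 1 := by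
  have h1 : 1 - τ / κ = Real.exp (-τ) := by linarith
  have h2 := Real.add_one_lt_exp hτpos.ne'
  have h3 : Real.exp (-τ) * Real.exp τ = 1 := by rw [← Real.exp_add]; simp
  have h4 : κ * (1 - Real.exp (-τ)) = τ := by rw [← h1]; field_simp; ring
  rw [h1]
  have h5 : 0 < Real.exp (-τ) := Real.exp_pos _
  nlinarith

lemma factorial_le_exp {M : ℕ} (hM : 1 ≤ M) :
    (M.factorial : ℝ) ≤ M * Real.exp (1 + M * Real.log M - M) := by
  induction M, hM using Nat.le_induction with
  | base => simp
  | succ M hM ih =>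
    have hM0 : (0 : ℝ) < M := by exact_mod_cast hM
    have h1 := Real.one_sub_inv_le_log_of_pos (div_pos (by linarith : (0 : ℝ) < M + 1) hM0)
    rw [Real.log_div (by linarith) hM0.ne', inv_div] at h1
    have h2 : 1 ≤ (M + 1) * (Real.log (M + 1) - Real.log M) := by
      calc (1 : ℝ) = (M + 1) * (1 - M / (M + 1)) := by field_simp; ring
        _ ≤ _ := by gcongr
    rw [Nat.factorial_succ]
    push_cast
    calc ((M : ℝ) + 1) * M.factorial ≤ (M + 1) * (M * Real.exp (1 + M * Real.log M - M)) := by gcongr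
      _ = (M + 1) * Real.exp (Real.log M + (1 + M * Real.log M - M)) := by
          rw [Real.exp_add, Real.exp_log hM0]
      _ ≤ _ := by
          gcongr
          linarith

lemma choose_le_exp {n j : ℕ} (hj : 1 ≤ j) (hjn : j ≤ n) :
    (n.choose j : ℝ) ≤
      Real.exp (n * (Real.negMulLog (j / n) + Real.negMulLog (1 - j / n))) := by
  have hn : (0 : ℝ) < n := by exact_mod_cast (by omega : 0 < n)
  have hj0 : (0 : ℝ) < j := by exact_mod_cast hj
  have hjn' : (j : ℝ) ≤ n := by exact_mod_cast hjn
  set x : ℝ := j / n with hx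
  have hx0 : 0 < x := by positivity
  have hx1 : x ≤ 1 := (div_le_one hn).2 hjn'
  have hnx : n * x = j := by rw [hx]; field_simp
  have h1 : x ^ j * (1 - x) ^ (n - j) * n.choose j ≤ 1 := by
    have h := add_pow x (1 - x) n
    rw [add_sub_cancel, one_pow] at h
    refine le_of_le_of_eq ?_ h.symm
    exact Finset.single_le_sum (f := fun m => x ^ m * (1 - x) ^ (n - m) * (n.choose m : ℝ))
      (fun m _ => mul_nonneg (mul_nonneg (by positivity) (pow_nonneg (by linarith) _))
        (by positivity)) (Finset.mem_range.2 (by omega : j < n + 1))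
  have h2 : x ^ j = Real.exp (-(n * Real.negMulLog x)) := by
    rw [Real.negMulLog, ← Real.rpow_natCast, Real.rpow_def_of_pos hx0, ← hnx]
    congr 1; ring
  have h3 : (1 - x) ^ (n - j) = Real.exp (-(n * Real.negMulLog (1 - x))) := by
    rcases hjn.eq_or_lt with h | h
    · have : x = 1 := by rw [hx, h]; exact div_self hn.ne'
      simp [this, h]
    · have hjn'' : (j : ℝ) < n := by exact_mod_cast h
      have hx1 : 0 < 1 - x := by rw [sub_pos, hx, div_lt_one hn]; exact hjn''
      rw [Real.negMulLog, ← Real.rpow_natCast, Real.rpow_def_of_pos hx1, Nat.cast_sub hjn, ← hnx]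
      congr 1; ring
  rw [h2, h3, ← Real.exp_add] at h1
  have h4 := mul_le_mul_of_nonneg_left h1
    (Real.exp_pos (n * (Real.negMulLog x + Real.negMulLog (1 - x)))).le
  rw [← mul_assoc, ← Real.exp_add] at h4
  ring_nf at h4 ⊢
  simpa using h4

lemma choose_mul_le_exp_rate {n j k : ℕ} {ν : ℝ} (hk : 0 < k) (hν : 0 < ν) (hν1 : ν < 1)
    (hlog : Real.log (1 - ν) = -(k * ν)) (hj : 1 ≤ j) (hjn : j ≤ n) :
    n.choose j * ((k * j).factorial * (Real.exp (k * ν) - 1) ^ j /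
      ((k * ν) ^ (k * j) * n ^ (k * j))) ≤ k * n * Real.exp (1 + n * rate k ν (j / n)) := by
  have hn : (0 : ℝ) < n := by exact_mod_cast (by omega : 0 < n)
  have hj0 : (0 : ℝ) < j := by exact_mod_cast hj
  have hk0 : (0 : ℝ) < k := by exact_mod_cast hk
  have hjn' : (j : ℝ) ≤ n := by exact_mod_cast hjn
  have h1 := choose_le_exp hj hjn
  have h2 := factorial_le_exp (M := k * j) (Nat.mul_pos hk hj)
  have h3 : Real.exp (k * ν) - 1 = Real.exp (Real.log ν + k * ν) := by
    have e1 : Real.exp (-(k * ν)) = 1 - ν := by rw [← hlog, Real.exp_log (by linarith)]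
    have e2 : Real.exp (k * ν) * Real.exp (-(k * ν)) = 1 := by rw [← Real.exp_add]; simp
    rw [e1] at e2
    rw [Real.exp_add, Real.exp_log hν]
    linarith
  have h4 : (k * ν) ^ (k * j) * (n : ℝ) ^ (k * j) =
      Real.exp (k * j * (Real.log k + Real.log ν + Real.log n)) := by
    rw [← mul_pow, ← Real.rpow_natCast, Real.rpow_def_of_pos (by positivity),
      Real.log_mul (by positivity) hn.ne', Real.log_mul hk0.ne' hν.ne']
    push_cast
    congr 1; ring
  have h5 : (Real.exp (k * ν) - 1) ^ j = Real.exp (j * (Real.log ν + k * ν)) := by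
    rw [h3, ← Real.exp_nat_mul]
  rw [h4, h5]
  calc _ ≤ Real.exp (n * (Real.negMulLog (j / n) + Real.negMulLog (1 - j / n))) *
        (((k * j : ℕ) : ℝ) * Real.exp (1 + (k * j : ℕ) * Real.log (k * j : ℕ) - (k * j : ℕ)) *
          Real.exp (j * (Real.log ν + k * ν)) /
            Real.exp (k * j * (Real.log k + Real.log ν + Real.log n))) := by gcongr
    _ = k * j * Real.exp (1 + n * rate k ν (j / n)) := by
        have e1 : (n : ℝ) * (j / n) = j := by field_simp
        have e2 : Real.log ((k * j : ℕ) : ℝ) =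
            Real.log k + (Real.log (j / n) + Real.log n) := by
          push_cast
          rw [Real.log_mul hk0.ne' hj0.ne', Real.log_div hj0.ne' hn.ne']
          ring
        rw [e2, rate]
        simp only [Real.negMulLog]
        set x : ℝ := j / n with hx
        rw [mul_assoc, ← Real.exp_add, mul_div_assoc, ← Real.exp_sub, mul_left_comm, ← Real.exp_add]
        push_cast
        rw [← e1]
        congr 2
        ring
    _ ≤ _ := by gcongr

lemma choose_mul_div_pow_le {n j k : ℕ} (hk : 2 ≤ k) (hj : 1 ≤ j) (hjn : 6 * j ≤ n) :
    n.choose j * ((j : ℝ) / n) ^ (k * j) ≤ 2 * Real.exp 1 / n * (j * (1 / 2) ^ j) := by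
  have hn : (0 : ℝ) < n := by exact_mod_cast (by omega : 0 < n)
  have hj0 : (0 : ℝ) < j := by exact_mod_cast hj
  have hjn' : 6 * (j : ℝ) ≤ n := by exact_mod_cast hjn
  have h1 : ((j : ℝ) / n) ^ (k * j) ≤ ((j : ℝ) / n) ^ (j + j) :=
    pow_le_pow_of_le_one (by positivity) (by rw [div_le_one hn]; linarith) (by nlinarith)
  have h2 : (n.choose j : ℝ) ≤ (n : ℝ) ^ j / j.factorial := Nat.choose_le_pow_div j n
  have h3 : (j : ℝ) ^ j / j.factorial ≤ Real.exp 1 ^ j := by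
    rw [← Real.exp_nat_mul, mul_one]
    exact Real.pow_div_factorial_le_exp _ hj0.le _
  have h4 : Real.exp 1 * (j / n) ≤ 1 / 2 := by
    have := Real.exp_one_lt_d9
    rw [← mul_div_assoc, div_le_iff₀ hn]
    nlinarith
  calc n.choose j * ((j : ℝ) / n) ^ (k * j)
      ≤ (n : ℝ) ^ j / j.factorial * ((j : ℝ) / n) ^ (j + j) := by gcongr
    _ = (j : ℝ) ^ j / j.factorial * ((j : ℝ) / n) ^ j := by
        rw [pow_add, div_pow]; field_simp
    _ ≤ Real.exp 1 ^ j * ((j : ℝ) / n) ^ j := by gcongr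
    _ = (Real.exp 1 * (j / n)) ^ (j - 1) * (Real.exp 1 * (j / n)) := by
        rw [← mul_pow, ← pow_succ]; congr 1; omega
    _ ≤ (1 / 2) ^ (j - 1) * (Real.exp 1 * (j / n)) := by gcongr
    _ = _ := by
        obtain ⟨i, rfl⟩ : ∃ i, j = i + 1 := ⟨j - 1, by omega⟩
        rw [pow_succ]; simp; ring

lemma prob_exists_isCovered_le {n k : ℕ} {ν δ c : ℝ} (hk : 2 ≤ k) (hν : 0 < ν) (hν1 : ν < 1)
    (hlog : Real.log (1 - ν) = -(k * ν))
    (hc : ∀ x, 1 / 6 ≤ x → x ≤ 1 → δ ≤ |x - ν| → rate k ν x ≤ -c) :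
    prob n k (fun f => ∃ S : Finset (Fin n), S.Nonempty ∧ IsCovered f S ∧
      δ ≤ |(S.card : ℝ) / n - ν|) ≤
      4 * Real.exp 1 / n + (n + 1) * (k * n * Real.exp (1 - n * c)) := by
  set h : ℕ → ℝ := fun j => 2 * Real.exp 1 / n * (j * (1 / 2) ^ j) +
    k * n * Real.exp (1 - n * c) with hh
  have hpos : ∀ j, 0 ≤ h j := fun j => by positivity
  have key : ∀ S : Finset (Fin n), S.Nonempty → δ ≤ |(S.card : ℝ) / n - ν| →
      prob n k (fun f => IsCovered f S) ≤ h S.card / n.choose S.card := by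
    intro S hS hδ
    have hj : 1 ≤ S.card := hS.card_pos
    have hjn : S.card ≤ n := by simpa using S.card_le_univ
    have hC : (0 : ℝ) < n.choose S.card := by exact_mod_cast Nat.choose_pos hjn
    have hn : (0 : ℝ) < n := by exact_mod_cast (by omega : 0 < n)
    rw [le_div_iff₀' hC]
    have hk0 : (0 : ℝ) < k := by exact_mod_cast (by omega : 0 < k)
    rcases le_or_gt (6 * S.card) n with h6 | h6
    · refine (mul_le_mul_of_nonneg_left (prob_isCovered_le_div_pow S) hC.le).trans
        ((choose_mul_div_pow_le hk hj h6).trans ?_)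
      rw [hh]
      exact le_add_of_nonneg_right (by positivity)
    · have h6' : (n : ℝ) ≤ 6 * S.card := by exact_mod_cast h6.le
      have hx := hc (S.card / n) (by rw [div_le_div_iff₀ (by norm_num) hn]; linarith)
        ((div_le_one hn).2 (by exact_mod_cast hjn)) hδ
      refine (mul_le_mul_of_nonneg_left (prob_isCovered_le (z := k * ν) (by positivity) S hS)
        hC.le).trans ((choose_mul_le_exp_rate (by omega) hν hν1 hlog hj hjn).trans ?_)
      refine le_add_of_nonneg_of_le (by positivity) ?_
      gcongr
      nlinarith
  have hgeom : ∑ j ∈ Finset.range (n + 1), (j : ℝ) * (1 / 2) ^ j ≤ 2 := by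
    have := hasSum_coe_mul_geometric_of_norm_lt_one (r := (1 / 2 : ℝ)) (by norm_num)
    norm_num at this
    norm_num
    exact sum_le_hasSum _ (fun j _ => by positivity) this
  calc _ ≤ prob n k (fun f => ∃ S ∈ Finset.univ.filter fun S : Finset (Fin n) =>
          S.Nonempty ∧ δ ≤ |(S.card : ℝ) / n - ν|, IsCovered f S) := by
        refine prob_mono ?_
        rintro f ⟨S, h1, h2, h3⟩
        exact ⟨S, by simp [h1, h3], h2⟩
    _ ≤ _ := prob_exists_le _ _
    _ ≤ ∑ S ∈ Finset.univ.filter fun S : Finset (Fin n) =>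
          S.Nonempty ∧ δ ≤ |(S.card : ℝ) / n - ν|, h S.card / n.choose S.card := by
        refine Finset.sum_le_sum fun S hS => ?_
        simp only [Finset.mem_filter] at hS
        exact key S hS.2.1 hS.2.2
    _ ≤ ∑ S ∈ (Finset.univ : Finset (Fin n)).powerset, h S.card / n.choose S.card := by
        refine Finset.sum_le_sum_of_subset_of_nonneg (fun S _ => by simp) fun S _ _ => ?_
        exact div_nonneg (hpos _) (by positivity)
    _ = ∑ j ∈ Finset.range (n + 1), h j := by
        rw [Finset.sum_powerset_apply_card (fun j => h j / n.choose j)]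
        simp only [Finset.card_univ, Fintype.card_fin, nsmul_eq_mul]
        refine Finset.sum_congr rfl fun j hj => ?_
        have : (0 : ℝ) < n.choose j := by
          exact_mod_cast Nat.choose_pos (by simpa [Nat.lt_succ_iff] using hj)
        field_simp
    _ = 2 * Real.exp 1 / n * ∑ j ∈ Finset.range (n + 1), (j : ℝ) * (1 / 2) ^ j +
          (n + 1) * (k * n * Real.exp (1 - n * c)) := by
        rw [hh, Finset.sum_add_distrib, ← Finset.mul_sum]; simp
    _ ≤ 2 * Real.exp 1 / n * 2 + (n + 1) * (k * n * Real.exp (1 - n * c)) := by gcongr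
    _ = _ := by ring

lemma tendsto_prob_exists_isCovered {k : ℕ} {ν δ : ℝ} (hk : 2 ≤ k) (hν : 0 < ν) (hν1 : ν < 1)
    (hkν : k * (1 - ν) < 1) (hlog : Real.log (1 - ν) = -(k * ν)) (hδ : 0 < δ) :
    Tendsto (fun n : ℕ => prob n k (fun f => ∃ S : Finset (Fin n), S.Nonempty ∧ IsCovered f S ∧
      δ ≤ |(S.card : ℝ) / n - ν|)) atTop (nhds 0) := by
  obtain ⟨c, hc0, hc⟩ := exists_rate_le (κ := k) (d := 1 / 6) (by exact_mod_cast hk) hν hν1 hkν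
    hlog hδ (by norm_num)
  refine squeeze_zero (fun n => prob_nonneg _)
    (fun n => prob_exists_isCovered_le hk hν hν1 hlog hc) ?_
  have h1 : Tendsto (fun n : ℕ => 4 * Real.exp 1 / (n : ℝ)) atTop (nhds 0) :=
    tendsto_const_nhds.div_atTop tendsto_natCast_atTop_atTop
  have hp : ∀ p : ℕ, Tendsto (fun n : ℕ => (n : ℝ) ^ p * Real.exp (-c * n)) atTop (nhds 0) := by
    intro p
    have := (tendsto_rpow_mul_exp_neg_mul_atTop_nhds_zero p c hc0).comp
      tendsto_natCast_atTop_atTop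
    simpa [Function.comp_def] using this
  have h2 := (((hp 2).add (hp 1)).const_mul (k * Real.exp 1)).add h1
  simp only [add_zero, mul_zero] at h2
  refine h2.congr fun n => ?_
  rw [sub_eq_add_neg, Real.exp_add, ← neg_mul, mul_comm (-(n : ℝ)), mul_neg, ← neg_mul]
  ring

lemma IsClosedSet.mem_of_reaches {n k : ℕ} {f : Fin n × Fin k → Fin n} {S : Set (Fin n)}
    (hS : IsClosedSet f S) {u v : Fin n} (hu : u ∈ S) (h : Reaches f u v) : v ∈ S := by
  induction h with
  | refl => exact hu
  | tail _ h ih =>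
    obtain ⟨i, rfl⟩ := h
    exact hS _ ih i

lemma IsClosedSet.isCovered {n k : ℕ} (hk : 0 < k) {f : Fin n × Fin k → Fin n}
    {S : Finset (Fin n)} (hS : IsClosedSet f S) (hS' : IsStrConn f S) : IsCovered f S := by
  refine ⟨fun v hv i => hS v hv i, fun v hv => ?_⟩
  have hw : f (v, ⟨0, hk⟩) ∈ (S : Set (Fin n)) := hS v hv ⟨0, hk⟩
  rcases Relation.ReflTransGen.cases_tail (hS'.2 _ hw v hv) with h | ⟨u, hu, i, hi⟩
  · exact ⟨v, hv, _, h.symm⟩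
  · exact ⟨u, hS.mem_of_reaches hw hu, i, hi⟩

lemma IsClosedSet.eq_of_isStrConn {n k : ℕ} {f : Fin n × Fin k → Fin n} {S T : Set (Fin n)}
    (hS : IsClosedSet f S) (hS' : IsStrConn f S) (hT : IsClosedSet f T) (hT' : IsStrConn f T)
    {x : Fin n} (hxS : x ∈ S) (hxT : x ∈ T) : S = T :=
  Set.Subset.antisymm (fun _ hy => hT.mem_of_reaches hxT (hS'.2 _ hxS _ hy))
    fun _ hy => hS.mem_of_reaches hxS (hT'.2 _ hxT _ hy)

lemma IsClosedSet.congr {n k : ℕ} {f g : Fin n × Fin k → Fin n} {S : Set (Fin n)}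
    (h : ∀ v ∈ S, ∀ i, f (v, i) = g (v, i)) (hS : IsClosedSet f S) : IsClosedSet g S :=
  fun v hv i => h v hv i ▸ hS v hv i

lemma IsStrConn.congr {n k : ℕ} {f g : Fin n × Fin k → Fin n} {S : Set (Fin n)}
    (h : ∀ v ∈ S, ∀ i, f (v, i) = g (v, i)) (hS : IsClosedSet f S) (hS' : IsStrConn f S) :
    IsStrConn g S := by
  refine ⟨hS'.1, fun u hu v hv => ?_⟩
  induction hS'.2 u hu v hv with
  | refl => exact Relation.ReflTransGen.refl
  | @tail b c hb hc ih =>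
    have hbS := hS.mem_of_reaches hu hb
    obtain ⟨i, hi⟩ := hc
    exact (ih hbS).tail ⟨i, by rw [← h b hbS i, hi]⟩

/-- Revealing the giant: if its size is concentrated on a window above `n / 2`, then an event about
the rows off the giant is no more likely than for a fixed set of vertices in the window. -/
lemma prob_exists_isGiant_le {n k : ℕ} (hk : 0 < k) {ν δ b : ℝ} (hν : 1 / 2 < ν - δ) (hb0 : 0 ≤ b)
    (B : Set (Fin n) → (Fin n × Fin k → Fin n) → Prop)
    (hB : ∀ G (f g : Fin n × Fin k → Fin n),
      (∀ v ∉ G, ∀ i, f (v, i) = g (v, i)) → B G f → B G g)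
    (hb : ∀ G : Finset (Fin n), |(G.card : ℝ) / n - ν| < δ → prob n k (B G) ≤ b) :
    prob n k (fun f => ∃ G, IsGiant f G ∧ B G f) ≤
      prob n k (fun f => ∃ S : Finset (Fin n), S.Nonempty ∧ IsCovered f S ∧
        δ ≤ |(S.card : ℝ) / n - ν|) + b := by
  set W : Finset (Finset (Fin n)) := Finset.univ.filter fun G => |(G.card : ℝ) / n - ν| < δ with hW
  set C : Finset (Fin n) → (Fin n × Fin k → Fin n) → Prop :=
    fun G f => IsClosedSet f (G : Set (Fin n)) ∧ IsStrConn f (G : Set (Fin n)) with hC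
  have huniq : ∀ f, ∀ S ∈ W, ∀ T ∈ W, C S f → C T f → S = T := by
    intro f S hS T hT hSf hTf
    simp only [hW, Finset.mem_filter, Finset.mem_univ, true_and, abs_lt] at hS hT
    have : ¬ Disjoint S T := by
      intro hd
      have h1 := Finset.card_union_of_disjoint hd
      have h2 : (S ∪ T).card ≤ n := by simpa using (S ∪ T).card_le_univ
      have h3 : (S.card : ℝ) + T.card ≤ n := by exact_mod_cast h1 ▸ h2
      have h4 : (0 : ℝ) < n := by
        rcases Nat.eq_zero_or_pos n with rfl | h
        · simp at hS; linarith
        · exact_mod_cast h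
      have h5 : ((S.card : ℝ) + T.card) / n ≤ 1 := (div_le_one h4).2 h3
      rw [add_div] at h5
      linarith [hS.1, hT.1]
    obtain ⟨x, hxS, hxT⟩ := Finset.not_disjoint_iff.1 this
    exact Finset.coe_injective (hSf.1.eq_of_isStrConn hSf.2 hTf.1 hTf.2 hxS hxT)
  have hsum : ∑ G ∈ W, prob n k (C G) ≤ 1 := by
    set g : (Fin n × Fin k → Fin n) → Finset (Fin n) :=
      fun f => if h : ∃ G ∈ W, C G f then h.choose else ∅ with hg
    calc _ ≤ ∑ G ∈ W, prob n k (fun f => True ∧ g f = G) := by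
          refine Finset.sum_le_sum fun G hG => prob_mono fun f hf => ⟨trivial, ?_⟩
          have h : ∃ G ∈ W, C G f := ⟨G, hG, hf⟩
          rw [hg]
          simp only [dif_pos h]
          exact huniq f _ h.choose_spec.1 _ hG h.choose_spec.2 hf
      _ = _ := sum_prob_eq _ _ _
      _ ≤ 1 := prob_le_one _
  calc _ ≤ prob n k (fun f => (∃ S : Finset (Fin n), S.Nonempty ∧ IsCovered f S ∧
        δ ≤ |(S.card : ℝ) / n - ν|) ∨ ∃ G ∈ W, C G f ∧ B G f) := by
        refine prob_mono ?_
        rintro f ⟨G, ⟨h1, h2, -⟩, h3⟩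
        lift G to Finset (Fin n) using Set.toFinite G
        by_cases h : |(G.card : ℝ) / n - ν| < δ
        · exact Or.inr ⟨G, by simp [hW, h], ⟨h1, h2⟩, h3⟩
        · exact Or.inl ⟨G, Finset.coe_nonempty.1 h2.1, h1.isCovered hk h2, not_lt.1 h⟩
    _ ≤ _ := prob_or_le _ _
    _ ≤ prob n k (fun f => ∃ S : Finset (Fin n), S.Nonempty ∧ IsCovered f S ∧
        δ ≤ |(S.card : ℝ) / n - ν|) + b := by
        gcongr
        calc _ ≤ ∑ G ∈ W, prob n k (fun f => C G f ∧ B G f) :=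
              prob_exists_le W fun G f => C G f ∧ B G f
          _ ≤ ∑ G ∈ W, prob n k (C G) * b := by
              refine Finset.sum_le_sum fun G hG => ?_
              rw [prob_and_eq_mul (G : Set (Fin n)) (C G) (B G)
                (fun f g h hf => ⟨hf.1.congr h, hf.2.congr h hf.1⟩) (hB G)]
              exact mul_le_mul_of_nonneg_left (hb G (by simpa [hW] using hG)) (prob_nonneg _)
          _ = (∑ G ∈ W, prob n k (C G)) * b := by rw [Finset.sum_mul]
          _ ≤ b := mul_le_of_le_one_left hb0 hsum

lemma tendsto_prob_exists_isGiant_le_reach {k : ℕ} {ν y lam a : ℝ} (hk : 2 ≤ k) (hν : 0 < ν)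
    (hν1 : ν < 1) (hkν : k * (1 - ν) < 1) (hlog : Real.log (1 - ν) = -(k * ν)) (hy1 : 1 ≤ y)
    (hy : (1 - ν) * y = ν / (k - 1)) (hlam : (ν * k / (k - 1)) ^ k = lam * y)
    (hlam0 : 0 < lam) (ha : 0 < a) (halam : a * Real.log lam < -1) :
    Tendsto (fun n : ℕ => prob n k (fun f => ∃ G, IsGiant f G ∧
      ∃ v ∉ G, ⌈a * Real.log n⌉₊ ≤ (reach f G.toFinset {v}).card)) atTop (nhds 0) := by
  have hy0 : 0 < y := by linarith
  have hk2 : (2 : ℝ) ≤ k := by exact_mod_cast hk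
  have hν2 : 1 / 2 < ν := by nlinarith
  obtain ⟨δ, ⟨hδ1, hδ2⟩, hδ0⟩ : ∃ δ : ℝ, (a * Real.log ((1 + (1 - ν + δ) * (y - 1)) ^ k / y) < -1 ∧
      δ < ν - 1 / 2) ∧ 0 < δ := by
    have h0 : (1 + (1 - ν + 0) * (y - 1)) ^ k / y = lam := by
      rw [div_eq_iff hy0.ne', ← hlam]
      congr 1
      have : (k : ℝ) - 1 ≠ 0 := by linarith
      have : 1 + (1 - ν + 0) * (y - 1) = (1 - ν) * y + ν := by ring
      rw [this, hy]
      field_simp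
      ring
    have hc : ContinuousAt (fun δ : ℝ => a * Real.log ((1 + (1 - ν + δ) * (y - 1)) ^ k / y)) 0 := by
      refine continuousAt_const.mul (ContinuousAt.log (by fun_prop) ?_)
      rw [h0]; exact hlam0.ne'
    have h1 : ∀ᶠ δ in nhds (0 : ℝ), a * Real.log ((1 + (1 - ν + δ) * (y - 1)) ^ k / y) < -1 :=
      hc.eventually_lt continuousAt_const (by simpa only [h0] using halam)
    have h2 : ∀ᶠ δ in nhds (0 : ℝ), δ < ν - 1 / 2 := eventually_lt_nhds (by linarith)
    exact (((h1.and h2).filter_mono nhdsWithin_le_nhds).and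
      (self_mem_nhdsWithin (s := Set.Ioi (0 : ℝ)))).exists
  set c : ℝ := 1 - ν + δ with hcdef
  set β : ℝ := (1 + c * (y - 1)) ^ k / y with hβ
  have hβ0 : 0 < β := by
    have : 0 ≤ c * (y - 1) := mul_nonneg (by linarith) (by linarith)
    positivity
  have hlogβ : Real.log β < 0 := by nlinarith
  have hβ1 : β ≤ 1 := by
    by_contra! h
    exact absurd (Real.log_pos h) (by linarith)
  have key : ∀ᶠ n : ℕ in atTop, prob n k (fun f => ∃ G, IsGiant f G ∧
      ∃ v ∉ G, ⌈a * Real.log n⌉₊ ≤ (reach f G.toFinset {v}).card) ≤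
      prob n k (fun f => ∃ S : Finset (Fin n), S.Nonempty ∧ IsCovered f S ∧
        δ ≤ |(S.card : ℝ) / n - ν|) + y * Real.exp (Real.log n * (1 + a * Real.log β)) := by
    filter_upwards [eventually_gt_atTop 0] with n hn
    have hn' : (0 : ℝ) < n := by exact_mod_cast hn
    refine prob_exists_isGiant_le (by omega) (by linarith) (by positivity)
      (fun G f => ∃ v ∉ G, ⌈a * Real.log n⌉₊ ≤ (reach f G.toFinset {v}).card) ?_ ?_
    · rintro G f g h ⟨v, hv, hvt⟩
      refine ⟨v, hv, ?_⟩
      rwa [← reach_congr (f := f)]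
      intro w hw i
      exact h w (by simpa using hw) i
    · intro G hG
      have hX : (n : ℝ) - G.card ≤ c * n := by
        have := (abs_lt.1 hG).1
        rw [lt_sub_iff_add_lt, lt_div_iff₀ hn'] at this
        rw [hcdef]; linarith
      set t := ⌈a * Real.log n⌉₊ with ht
      have hβt : β ^ t ≤ Real.exp (Real.log β * (a * Real.log n)) := by
        rw [← Real.rpow_def_of_pos hβ0, ← Real.rpow_natCast]
        exact Real.rpow_le_rpow_of_exponent_ge hβ0 hβ1 (Nat.le_ceil _)
      calc _ ≤ prob n k (fun f => ∃ v ∈ Gᶜ, t ≤ (reach f G {v}).card) := by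
            refine prob_mono ?_
            rintro f ⟨v, hv, hvt⟩
            exact ⟨v, by simpa using hv, by simpa using hvt⟩
        _ ≤ ∑ v ∈ Gᶜ, prob n k (fun f => t ≤ (reach f G {v}).card) := prob_exists_le _ _
        _ ≤ ∑ v ∈ Gᶜ, y * β ^ t := by
            refine Finset.sum_le_sum fun v hv => ?_
            refine (prob_le_card_reach hy1 hβ0.le (c := c) ?_ t G {v} hX).trans ?_
            · rw [hβ, div_mul_cancel₀ _ hy0.ne']
            · refine mul_le_mul_of_nonneg_right ?_ (by positivity)
              have : ({v} \ G : Finset (Fin n)).card ≤ 1 :=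
                (Finset.card_le_card Finset.sdiff_subset).trans (by simp)
              simpa using pow_le_pow_right₀ hy1 this
        _ ≤ n * (y * β ^ t) := by
            rw [Finset.sum_const, nsmul_eq_mul]
            gcongr
            simpa using Gᶜ.card_le_univ
        _ ≤ n * (y * Real.exp (Real.log β * (a * Real.log n))) := by gcongr
        _ = y * Real.exp (Real.log n * (1 + a * Real.log β)) := by
            rw [mul_add, Real.exp_add, mul_one, Real.exp_log hn']
            ring_nf
  refine squeeze_zero' (Eventually.of_forall fun n => prob_nonneg _) key ?_
  have h2 : Tendsto (fun n : ℕ => y * Real.exp (Real.log n * (1 + a * Real.log β))) atTop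
      (nhds (y * 0)) :=
    (Real.tendsto_exp_atBot.comp ((Real.tendsto_log_atTop.comp
      tendsto_natCast_atTop_atTop).atTop_mul_const_of_neg (by linarith))).const_mul y
  simpa using (tendsto_prob_exists_isCovered hk hν hν1 hkν hlog hδ0).add h2

lemma eventually_floor_rpow_mul_le {r a C δ : ℝ} (hr0 : 0 < r) (hr1 : r < 1) (ha : 0 < a)
    (hC : 0 ≤ C) (hδ : 0 < δ) :
    ∀ᶠ n : ℕ in atTop,
      (⌊(n : ℝ) ^ r⌋₊ : ℝ) * ⌈a * Real.log n⌉₊ + ⌈a * Real.log n⌉₊ + C ≤ δ * n := by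
  have h1 : (fun x : ℝ => 2 * a * Real.log x + (2 + C)) =o[atTop] fun x => x ^ (1 - r) :=
    ((isLittleO_log_rpow_atTop (by linarith)).const_mul_left _).add
      (Asymptotics.isLittleO_const_left.2 (Or.inr
        (tendsto_norm_atTop_atTop.comp (tendsto_rpow_atTop (by linarith)))))
  have h2 := tendsto_natCast_atTop_atTop.eventually (h1.bound hδ)
  filter_upwards [h2, eventually_ge_atTop 1] with n hn hn1
  have hn1' : (1 : ℝ) ≤ n := by exact_mod_cast hn1
  have hn0 : (0 : ℝ) < n := by linarith
  have hlog : 0 ≤ Real.log n := Real.log_nonneg hn1'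
  have hr : 1 ≤ (n : ℝ) ^ r := Real.one_le_rpow hn1' hr0.le
  rw [Real.norm_eq_abs, Real.norm_eq_abs, abs_of_nonneg (by positivity),
    abs_of_nonneg (by positivity)] at hn
  have hJ : (⌊(n : ℝ) ^ r⌋₊ : ℝ) ≤ (n : ℝ) ^ r := Nat.floor_le (by positivity)
  have ht : (⌈a * Real.log n⌉₊ : ℝ) ≤ a * Real.log n + 1 := (Nat.ceil_lt_add_one (by positivity)).le
  calc _ ≤ (n : ℝ) ^ r * (a * Real.log n + 1) + (n : ℝ) ^ r * (a * Real.log n + 1) +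
        (n : ℝ) ^ r * C := by
        gcongr
        · exact ht.trans (le_mul_of_one_le_left (by positivity) hr)
        · exact le_mul_of_one_le_left hC hr
    _ = (n : ℝ) ^ r * (2 * a * Real.log n + (2 + C)) := by ring
    _ ≤ (n : ℝ) ^ r * (δ * n ^ (1 - r)) := by gcongr
    _ = δ * n := by
        rw [mul_left_comm, ← Real.rpow_add hn0]; simp

lemma prob_forall_reach_lt_le_exp {n k : ℕ} (hk : 2 ≤ k) {ν y lam η δ r a : ℝ} {K : ℕ}
    (hη0 : 0 < η) (hη1 : η < 1) (hν : 0 < ν) (hν1 : ν < 1) (hy1 : 1 ≤ y)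
    (hy : (1 - ν) * y = ν / (k - 1)) (hlam : (ν * k / (k - 1)) ^ k = lam * y)
    (hθ0 : 0 < lam * (1 - η) ^ (k + 1)) (hθ1 : lam * (1 - η) ^ (k + 1) < 1)
    (hK : 1 ≤ η * (K - 1)) (hK1 : 1 < K) (hδη : δ ≤ η * ν) (hδη' : 2 * δ ≤ η * (1 - ν))
    (ha : 0 < a) (hn : 0 < n)
    (hsmall : (⌊(n : ℝ) ^ r⌋₊ : ℝ) * ⌈a * Real.log n⌉₊ + ⌈a * Real.log n⌉₊ + (K + k) ≤ δ * n)
    (G : Finset (Fin n)) (hG : |(G.card : ℝ) / n - ν| < δ) :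
    prob n k (fun f => ∀ v ∉ G, (reach f G {v}).card < ⌈a * Real.log n⌉₊) ≤
      Real.exp (-((y ^ K * K ^ 2)⁻¹ * (y * (K - 1)) * (lam * (1 - η) ^ (k + 1)) *
        ((n : ℝ) ^ (a * Real.log (lam * (1 - η) ^ (k + 1))) * ((n : ℝ) ^ r - 1)))) := by
  set θ : ℝ := lam * (1 - η) ^ (k + 1) with hθ
  set t := ⌈a * Real.log n⌉₊ with ht
  set J := ⌊(n : ℝ) ^ r⌋₊ with hJ
  have hn' : (1 : ℝ) ≤ n := by exact_mod_cast hn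
  have hn0 : (0 : ℝ) < n := by linarith
  have hK1' : (1 : ℝ) < K := by exact_mod_cast hK1
  have hlog : 0 ≤ Real.log n := Real.log_nonneg hn'
  obtain ⟨hG1, hG2⟩ := abs_lt.1 hG
  rw [lt_sub_iff_add_lt, lt_div_iff₀ hn0] at hG1
  rw [sub_lt_iff_lt_add, div_lt_iff₀ hn0] at hG2
  have hJt : (0 : ℝ) ≤ J * t := by positivity
  have ht0 : (0 : ℝ) ≤ t := by positivity
  have hk0 : (2 : ℝ) ≤ k := by exact_mod_cast hk
  have hb : (G.card : ℝ) + J * t + t + K + k ≤ n - (1 - η) * (1 - ν) * n := by nlinarith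
  have hbn : G.card + J * t < n := by
    have h1 : 0 ≤ (1 - η) * (1 - ν) * n :=
      mul_nonneg (mul_nonneg (by linarith) (by linarith)) hn0.le
    have : (G.card : ℝ) + J * t < n := by linarith
    exact_mod_cast this
  have hprofile : profile K ((1 : ℕ) : ℝ) = K - 1 := by
    unfold profile
    rw [max_eq_right] <;> push_cast <;> linarith
  set D : ℝ := (y ^ K * K ^ 2)⁻¹ * (y * (K - 1)) with hD
  have hD0 : 0 < D := by
    have : (0 : ℝ) < K - 1 := by linarith
    positivity
  have h := prob_forall_reach_lt_le (n := n) (k := k) (t := t) (m := G.card)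
    (b := G.card + J * t) (p := D * θ ^ t) ?_ hbn J G le_rfl le_rfl
  · refine h.trans ?_
    rw [← Real.exp_nat_mul, Real.exp_le_exp, mul_neg, neg_le_neg_iff]
    have h1 : θ * (n : ℝ) ^ (a * Real.log θ) ≤ θ ^ t := by
      have : (n : ℝ) ^ (a * Real.log θ) = θ ^ (a * Real.log n) := by
        rw [Real.rpow_def_of_pos hn0, Real.rpow_def_of_pos hθ0]; ring_nf
      rw [this, ← Real.rpow_one_add' hθ0.le (by positivity), ← Real.rpow_natCast]
      refine Real.rpow_le_rpow_of_exponent_ge hθ0 hθ1.le ?_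
      rw [add_comm]
      exact (Nat.ceil_lt_add_one (by positivity)).le
    have h2 : (n : ℝ) ^ r - 1 ≤ J := (Nat.sub_one_lt_floor _).le
    calc _ = (n : ℝ) ^ r * 0 + ((n : ℝ) ^ r - 1) * (D * (θ * (n : ℝ) ^ (a * Real.log θ))) := by ring
      _ ≤ 0 + J * (D * (θ * (n : ℝ) ^ (a * Real.log θ))) := by
          rw [mul_zero]
          gcongr
      _ ≤ _ := by rw [zero_add]; gcongr
  · intro X v hv hX1 hX2
    have hX1' : (G.card : ℝ) ≤ X.card := by exact_mod_cast hX1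
    have hX2' : (X.card : ℝ) ≤ G.card + J * t := by exact_mod_cast hX2
    have := le_prob_reach (n := n) hk hη0 hη1 hν hν1 hy1 hy hlam hK (by omega) t X {v}
      (by simpa using hv) (by nlinarith) (by linarith)
    rw [Finset.card_singleton, hprofile, pow_one] at this
    refine le_trans (le_of_eq ?_) this
    rw [hD, hθ]; ring

lemma tendsto_prob_exists_isGiant_reach_lt {k : ℕ} {ν y lam a : ℝ} (hk : 2 ≤ k) (hν : 0 < ν)
    (hν1 : ν < 1) (hkν : k * (1 - ν) < 1) (hlog : Real.log (1 - ν) = -(k * ν)) (hy1 : 1 ≤ y)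
    (hy : (1 - ν) * y = ν / (k - 1)) (hlam : (ν * k / (k - 1)) ^ k = lam * y)
    (hlam0 : 0 < lam) (hlam1 : lam < 1) (ha : 0 < a) (halam : -1 < a * Real.log lam) :
    Tendsto (fun n : ℕ => prob n k (fun f => ∃ G, IsGiant f G ∧
      ∀ v ∉ G, (reach f G.toFinset {v}).card < ⌈a * Real.log n⌉₊)) atTop (nhds 0) := by
  have hk2 : (2 : ℝ) ≤ k := by exact_mod_cast hk
  have hν2 : 1 / 2 < ν := by nlinarith
  obtain ⟨η, ⟨hη, hη1⟩, hη0⟩ : ∃ η : ℝ, (-1 < a * Real.log (lam * (1 - η) ^ (k + 1)) ∧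
      η < 1) ∧ 0 < η := by
    have hc : ContinuousAt (fun η : ℝ => a * Real.log (lam * (1 - η) ^ (k + 1))) 0 :=
      continuousAt_const.mul (ContinuousAt.log (by fun_prop) (by simpa using hlam0.ne'))
    have h1 : ∀ᶠ η in nhds (0 : ℝ), -1 < a * Real.log (lam * (1 - η) ^ (k + 1)) :=
      continuousAt_const.eventually_lt hc (by simpa using halam)
    have h2 : ∀ᶠ η in nhds (0 : ℝ), η < 1 := eventually_lt_nhds (by norm_num)
    exact (((h1.and h2).filter_mono nhdsWithin_le_nhds).and
      (self_mem_nhdsWithin (s := Set.Ioi (0 : ℝ)))).exists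
  set θ : ℝ := lam * (1 - η) ^ (k + 1) with hθ
  have hη' : 0 < 1 - η := by linarith
  have hθ0 : 0 < θ := by positivity
  have hθ1 : θ < 1 := by
    have : (1 - η) ^ (k + 1) ≤ 1 := pow_le_one₀ hη'.le (by linarith)
    nlinarith
  have hlogθ := Real.log_neg hθ0 hθ1
  obtain ⟨K, hK⟩ := exists_nat_ge (1 / η + 1)
  have hK' : 1 ≤ η * ((K : ℝ) - 1) := by
    have : 1 / η ≤ (K : ℝ) - 1 := by linarith
    rwa [div_le_iff₀' hη0] at this
  have hK1 : 1 < K := by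
    have : 0 < 1 / η := by positivity
    exact_mod_cast (by linarith : (1 : ℝ) < K)
  obtain ⟨δ, hδ0, hδ⟩ : ∃ δ : ℝ, 0 < δ ∧ (δ ≤ η * ν ∧ 2 * δ ≤ η * (1 - ν) ∧ 1 / 2 < ν - δ) := by
    refine ⟨min (η * ν) (min (η * (1 - ν) / 2) ((ν - 1 / 2) / 2)), ?_, ?_, ?_, ?_⟩
    · have : 0 < 1 - ν := by linarith
      have : 0 < ν - 1 / 2 := by linarith
      positivity
    · exact min_le_left _ _
    · linarith [(min_le_right (η * ν) (min (η * (1 - ν) / 2) ((ν - 1 / 2) / 2))).trans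
        (min_le_left _ _)]
    · linarith [(min_le_right (η * ν) (min (η * (1 - ν) / 2) ((ν - 1 / 2) / 2))).trans
        (min_le_right _ _)]
  set s : ℝ := a * Real.log θ with hs
  have hs0 : s < 0 := mul_neg_of_pos_of_neg ha hlogθ
  set r : ℝ := (1 - s) / 2 with hr
  set D : ℝ := (y ^ K * K ^ 2)⁻¹ * (y * (K - 1)) * θ with hD
  have hD0 : 0 < D := by
    have : (1 : ℝ) < K := by exact_mod_cast hK1
    have : (0 : ℝ) < K - 1 := by linarith
    positivity
  have key : ∀ᶠ n : ℕ in atTop, prob n k (fun f => ∃ G, IsGiant f G ∧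
      ∀ v ∉ G, (reach f G.toFinset {v}).card < ⌈a * Real.log n⌉₊) ≤
      prob n k (fun f => ∃ S : Finset (Fin n), S.Nonempty ∧ IsCovered f S ∧
        δ ≤ |(S.card : ℝ) / n - ν|) + Real.exp (-(D * ((n : ℝ) ^ s * ((n : ℝ) ^ r - 1)))) := by
    filter_upwards [eventually_gt_atTop 0, eventually_floor_rpow_mul_le (r := r) (C := K + k)
      (by linarith) (by linarith) ha (by positivity) hδ0] with n hn hsmall
    refine prob_exists_isGiant_le (by omega) hδ.2.2 (by positivity)
      (fun G f => ∀ v ∉ G, (reach f G.toFinset {v}).card < ⌈a * Real.log n⌉₊) ?_ ?_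
    · intro G f g h hf v hv
      rw [← reach_congr (f := f)]
      · exact hf v hv
      · intro w hw i
        exact h w (by simpa using hw) i
    · intro G hG
      simp only [Finset.mem_coe, Finset.toFinset_coe]
      exact prob_forall_reach_lt_le_exp hk hη0 hη1 hν hν1 hy1 hy hlam hθ0 hθ1 hK' hK1
        hδ.1 hδ.2.1 ha hn hsmall G hG
  refine squeeze_zero' (Eventually.of_forall fun n => prob_nonneg _) key ?_
  have h1 : Tendsto (fun x : ℝ => D * (x ^ s * (x ^ r - 1))) atTop atTop := by
    have h2 : Tendsto (fun x : ℝ => x ^ (s + r) + -x ^ s) atTop atTop := by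
      refine (tendsto_rpow_atTop (by linarith)).atTop_add (C := 0) ?_
      simpa using (tendsto_rpow_neg_atTop (neg_pos.2 hs0)).neg
    refine (h2.const_mul_atTop hD0).congr' ?_
    filter_upwards [eventually_gt_atTop 0] with x hx
    rw [Real.rpow_add hx]; ring
  have h3 : Tendsto (fun n : ℕ => Real.exp (-(D * ((n : ℝ) ^ s * ((n : ℝ) ^ r - 1))))) atTop
      (nhds 0) :=
    Real.tendsto_exp_neg_atTop_nhds_zero.comp (h1.comp tendsto_natCast_atTop_atTop)
  simpa using (tendsto_prob_exists_isCovered hk hν hν1 hkν hlog hδ0).add h3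

lemma mul_pow_lt_one {s : ℝ} (hs : 0 < s) (hs1 : s < 1) (m : ℕ) :
    s * (1 + (1 - s) / m) ^ m < 1 := by
  calc s * (1 + (1 - s) / m) ^ m ≤ s * Real.exp (1 - s) := by
        gcongr
        rcases Nat.eq_zero_or_pos m with rfl | hm
        · simpa using Real.one_le_exp (by linarith : 0 ≤ 1 - s)
        · have : (m : ℝ) * ((1 - s) / m) = 1 - s := by field_simp
          rw [← this, Real.exp_nat_mul, this]
          have : 0 ≤ (1 - s) / m := div_nonneg (by linarith) (by positivity)
          gcongr
          linarith [Real.add_one_le_exp ((1 - s) / m)]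
    _ < Real.exp (s - 1) * Real.exp (1 - s) := by
        gcongr
        linarith [Real.add_one_lt_exp (x := s - 1) (by linarith)]
    _ = 1 := by rw [← Real.exp_add]; simp

/-- The maximum size `S_n` of a spectrum outside the giant satisfies
`S_n / log n → 1/log(1/λ_k)` in probability, where
`λ_k = (k-τ_k)(τ_k/(k-1))^{k-1}`. -/
theorem max_spectrum_outside_giant (k : ℕ) (hk : 2 ≤ k) (τ : ℝ) (hτpos : 0 < τ)
    (hτ : 1 - τ / k - Real.exp (-τ) = 0) (ε : ℝ) (hε : 0 < ε) :
    Filter.Tendsto (fun n : ℕ =>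
      prob n k (fun f => ∃ G : Set (Fin n), IsGiant f G ∧
        ε < |(((Finset.univ.filter fun v : Fin n => v ∉ G).sup
                fun v => (specIn f Gᶜ v).ncard : ℕ) : ℝ) / Real.log n -
              1 / Real.log (1 / (((k : ℝ) - τ) * (τ / ((k : ℝ) - 1)) ^ (k - 1)))|))
      Filter.atTop (nhds 0) := by
  have hk2 : (2 : ℝ) ≤ k := by exact_mod_cast hk
  have hk0 : (0 : ℝ) < k := by linarith
  have hk1 : (0 : ℝ) < k - 1 := by linarith
  obtain ⟨ν, rfl⟩ : ∃ ν : ℝ, τ = k * ν := ⟨τ / k, by field_simp⟩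
  have hν : 0 < ν := pos_of_mul_pos_right hτpos hk0.le
  have hkν := mul_lt_one_of_fixed hk0 hτpos hτ
  rw [mul_div_cancel_left₀ _ hk0.ne'] at hτ hkν
  have hexp : Real.exp (-(k * ν)) = 1 - ν := by linarith
  have hν1 : 0 < 1 - ν := hexp ▸ Real.exp_pos _
  have hlog : Real.log (1 - ν) = -(k * ν) := by rw [← hexp, Real.log_exp]
  set y : ℝ := ν / ((k - 1) * (1 - ν)) with hy
  have hy1 : 1 ≤ y := by
    rw [hy, one_le_div (by positivity)]
    linarith
  have hy' : (1 - ν) * y = ν / (k - 1) := by rw [hy]; field_simp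
  set lam : ℝ := ((k : ℝ) - k * ν) * (k * ν / ((k : ℝ) - 1)) ^ (k - 1) with hlam
  have hlam0 : 0 < lam := by
    have : (k : ℝ) - k * ν = k * (1 - ν) := by ring
    rw [hlam, this]
    positivity
  have hlam1 : lam < 1 := by
    convert mul_pow_lt_one (s := k * (1 - ν)) (by positivity) hkν (k - 1) using 1
    rw [hlam, Nat.cast_sub (by omega), Nat.cast_one]
    congr 1
    · ring
    · congr 1
      field_simp
      ring
  have hlamy : (ν * k / (k - 1)) ^ k = lam * y := by
    obtain ⟨m, rfl⟩ : ∃ m, k = m + 1 := ⟨k - 1, by omega⟩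
    rw [hlam, hy, Nat.add_sub_cancel, pow_succ, mul_comm ν]
    field_simp
  have hloglam := Real.log_neg hlam0 hlam1
  rw [one_div lam, Real.log_inv]
  set L : ℝ := 1 / -Real.log lam with hL
  have hL0 : 0 < L := one_div_pos.2 (by linarith)
  have hL1 : L * Real.log lam = -1 := by
    rw [hL, one_div_mul_eq_div, div_neg, div_self hloglam.ne]
  have hup := tendsto_prob_exists_isGiant_le_reach (a := L + ε) hk hν (by linarith) hkν hlog hy1 hy'
    hlamy hlam0 (by linarith) (by nlinarith)
  have hlo := tendsto_prob_exists_isGiant_reach_lt (a := max (L - ε) (L / 2)) hk hν (by linarith)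
    hkν hlog hy1 hy' hlamy hlam0 hlam1 (by positivity) (by
      have : max (L - ε) (L / 2) < L := max_lt (by linarith) (by linarith)
      nlinarith)
  have hsum := hup.add hlo
  rw [add_zero] at hsum
  refine squeeze_zero' (Eventually.of_forall fun n => prob_nonneg _) ?_ hsum
  filter_upwards [eventually_gt_atTop 1] with n hn
  have hlogn : 0 < Real.log n := Real.log_pos (by exact_mod_cast hn)
  refine (prob_mono ?_).trans (prob_or_le _ _)
  rintro f ⟨G, hG, h⟩
  have hcard : ∀ v ∉ G, (specIn f Gᶜ v).ncard = (reach f G.toFinset {v}).card :=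
    fun v hv => ncard_specIn G hv
  set S : ℕ := (Finset.univ.filter fun v : Fin n => v ∉ G).sup
    fun v => (specIn f Gᶜ v).ncard with hS
  rcases lt_abs.1 h with h | h
  · refine Or.inl ⟨G, hG, ?_⟩
    have h1 : (L + ε) * Real.log n < S := by
      rw [← lt_div_iff₀ hlogn]; linarith
    have h2 : ⌈(L + ε) * Real.log n⌉₊ ≤ S := Nat.ceil_le.2 h1.le
    rw [hS, Finset.le_sup_iff (Nat.ceil_pos.2 (by positivity))] at h2
    obtain ⟨v, hv, hvt⟩ := h2
    have hv' : v ∉ G := by simpa using hv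
    exact ⟨v, hv', hcard v hv' ▸ hvt⟩
  · refine Or.inr ⟨G, hG, fun v hv => ?_⟩
    have h1 : (S : ℝ) < (L - ε) * Real.log n := by
      rw [← div_lt_iff₀ hlogn]; linarith
    have h2 : (reach f G.toFinset {v}).card ≤ S := by
      rw [← hcard v hv]
      exact Finset.le_sup (f := fun v => (specIn f Gᶜ v).ncard) (by simpa using hv)
    refine h2.trans_lt (Nat.lt_ceil.2 (h1.trans_le ?_))
    gcongr
    exact le_max_left _ _
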